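/- There exists a constant c_n > 0, depending only on the dimension n, with the following property: if K is a convex body in ℝⁿ with V(K) = V(B) and 𝓔(K) ≤ ε ≤ 1, then |e_{-2}(K) − e(K)| ≤ c_n √ε, where e(K) is a point in the interior of K at which the supremum defining 𝓔(K) is attained and e_{-2}(K) is an interior point of K minimizing x ↦ ∫_{S^{n-1}} (s_K(u) − x·u)^{-2} dθ. -/

import Mathlib

open MeasureTheory Metric Real Set
open scoped Pointwise RealInnerProductSpace

noncomputable section

/-- The surface measure `dθ` on the unit sphere `S^{n-1}` of `ℝⁿ`
(its total mass is `n·V(B)`). -/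
def sphMeasure (n : ℕ) : Measure (Metric.sphere (0 : EuclideanSpace ℝ (Fin n)) 1) :=
  (volume : Measure (EuclideanSpace ℝ (Fin n))).toSphere

/-- `K` is a convex body: compact, convex, with nonempty interior. -/
def IsConvexBody {n : ℕ} (K : Set (EuclideanSpace ℝ (Fin n))) : Prop :=
  IsCompact K ∧ Convex ℝ K ∧ (interior K).Nonempty

/-- The support function of `K`: `s_K(u) = max_{x ∈ K} x·u`. -/
def supp {n : ℕ} (K : Set (EuclideanSpace ℝ (Fin n))) (u : EuclideanSpace ℝ (Fin n)) : ℝ :=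
  sSup ((fun x => ⟪x, u⟫) '' K)

/-- `n`-dimensional Lebesgue measure (volume), as a real number. -/
def vol {n : ℕ} (K : Set (EuclideanSpace ℝ (Fin n))) : ℝ :=
  (volume K).toReal

/-- The closed unit ball `B` of `ℝⁿ`. -/
def unitBall (n : ℕ) : Set (EuclideanSpace ℝ (Fin n)) :=
  Metric.closedBall 0 1

/-- The entropy functional `𝓔(K) = sup_{x ∈ int K} ∫_{S^{n-1}} log (s_K(u) - x·u) dθ`. -/
def entropy {n : ℕ} (K : Set (EuclideanSpace ℝ (Fin n))) : ℝ :=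
  sSup ((fun x => ∫ u, Real.log (supp K u - ⟪x, (u : EuclideanSpace ℝ (Fin n))⟫)
      ∂(sphMeasure n)) '' interior K)

/-- The `p`-entropy functional `𝓔_p(K) = inf_{x ∈ int K} ∫_{S^{n-1}} (s_K(u) - x·u)^p dθ`. -/
def entropyP {n : ℕ} (p : ℝ) (K : Set (EuclideanSpace ℝ (Fin n))) : ℝ :=
  sInf ((fun x => ∫ u, (supp K u - ⟪x, (u : EuclideanSpace ℝ (Fin n))⟫) ^ p
      ∂(sphMeasure n)) '' interior K)

/-- The Hausdorff distance between convex bodies,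
`δ_H(K,L) = sup_{u ∈ S^{n-1}} |s_K(u) - s_L(u)|`. -/
def hdist {n : ℕ} (K L : Set (EuclideanSpace ℝ (Fin n))) : ℝ :=
  ⨆ u : Metric.sphere (0 : EuclideanSpace ℝ (Fin n)) 1, |supp K u - supp L u|


/-! ### One-dimensional Brunn-Minkowski and Prékopa-Leindler -/

lemma bm_compact {A B : Set ℝ} (hA : IsCompact A) (hB : IsCompact B) (hA0 : A.Nonempty)
    (hB0 : B.Nonempty) : volume A + volume B ≤ volume (A + B) := by
  obtain ⟨a, haA, ha⟩ := hA.exists_isGreatest hA0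
  obtain ⟨b, hbB, hb⟩ := hB.exists_isLeast hB0
  have h1 : volume (b +ᵥ A) = volume A := measure_vadd _ _ _
  have h2 : volume (a +ᵥ B) = volume B := measure_vadd _ _ _
  have hd : AEDisjoint volume (b +ᵥ A) (a +ᵥ B) := by
    refine measure_mono_null (t := {a + b}) ?_ (by simp)
    rintro x ⟨⟨y, hy, rfl⟩, ⟨w, hw, hx⟩⟩
    have e1 := ha hy
    have e2 := hb hw
    simp only [vadd_eq_add] at hx ⊢
    simp only [mem_singleton_iff]
    linarith
  have hm : NullMeasurableSet (a +ᵥ B) volume :=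
    (hB.vadd a).measurableSet.nullMeasurableSet
  rw [← h1, ← h2, ← measure_union₀ hm hd]
  apply measure_mono
  rintro x (⟨y, hy, rfl⟩ | ⟨y, hy, rfl⟩)
  · exact ⟨y, hy, b, hbB, by simp [add_comm]⟩
  · exact ⟨a, haA, y, hy, by simp⟩

lemma bm_half {A B C : Set ℝ} (hA : MeasurableSet A) (hB : MeasurableSet B)
    (hA0 : A.Nonempty) (hB0 : B.Nonempty)
    (hC : ∀ a ∈ A, ∀ b ∈ B, (a + b) / 2 ∈ C) : volume A + volume B ≤ 2 * volume C := by
  have key : ∀ K₁, K₁ ⊆ A → IsCompact K₁ → ∀ K₂, K₂ ⊆ B → IsCompact K₂ →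
      volume K₁ + volume K₂ ≤ 2 * volume C := by
    intro K₁ h1 hc1 K₂ h2 hc2
    obtain ⟨a, ha⟩ := hA0
    obtain ⟨b, hb⟩ := hB0
    have hbm := bm_compact (hc1.insert a) (hc2.insert b) (insert_nonempty _ _) (insert_nonempty _ _)
    have h1' : insert a K₁ ⊆ A := insert_subset ha h1
    have h2' : insert b K₂ ⊆ B := insert_subset hb h2
    have hsub : insert a K₁ + insert b K₂ ⊆ (fun x : ℝ => x * (1/2)) ⁻¹' C := by
      rintro x ⟨y, hy, w, hw, rfl⟩
      have := hC y (h1' hy) w (h2' hw)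
      simpa [div_eq_mul_inv] using this
    calc volume K₁ + volume K₂ ≤ volume (insert a K₁) + volume (insert b K₂) := by
          gcongr <;> exact subset_insert _ _
      _ ≤ _ := hbm
      _ ≤ _ := measure_mono hsub
      _ = 2 * volume C := by
          rw [Real.volume_preimage_mul_right (by norm_num)]
          norm_num
  rw [hA.measure_eq_iSup_isCompact, hB.measure_eq_iSup_isCompact]
  simp only [iSup_and']
  refine ENNReal.biSup_add_biSup_le' (p := fun K => K ⊆ A ∧ IsCompact K)
    (q := fun K => K ⊆ B ∧ IsCompact K) ⟨∅, by simp⟩ ⟨∅, by simp⟩ ?_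
  intro i hi j hj
  exact key i hi.1 hi.2 j hj.1 hj.2

lemma pl_norm {f g h : ℝ → ℝ} (hf : Measurable f) (hg : Measurable g)
    (hf0 : ∀ x, 0 ≤ f x) (hg0 : ∀ x, 0 ≤ g x) (hh0 : ∀ x, 0 ≤ h x) (hh : Measurable h)
    (hf1 : ∀ x, f x ≤ 1) (hg1 : ∀ x, g x ≤ 1)
    (hfs : ∀ t < 1, ∃ x, t < f x) (hgs : ∀ t < 1, ∃ x, t < g x)
    (H : ∀ a b, f a * g b ≤ h ((a + b) / 2) ^ 2) :
    (∫⁻ x, ENNReal.ofReal (f x)) + (∫⁻ x, ENNReal.ofReal (g x))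
      ≤ 2 * ∫⁻ x, ENNReal.ofReal (h x) := by
  rw [lintegral_eq_lintegral_meas_lt _ (Filter.Eventually.of_forall hf0) hf.aemeasurable,
    lintegral_eq_lintegral_meas_lt _ (Filter.Eventually.of_forall hg0) hg.aemeasurable,
    lintegral_eq_lintegral_meas_lt _ (Filter.Eventually.of_forall hh0) hh.aemeasurable]
  have hanti : ∀ k : ℝ → ℝ, Antitone fun t : ℝ => volume {x | t < k x} := by
    intro k s t hst
    exact measure_mono fun x (hx : t < k x) => lt_of_le_of_lt hst hx
  rw [← lintegral_add_left (hanti f).measurable, ← lintegral_const_mul _ (hanti h).measurable]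
  refine setLIntegral_mono (by
    exact (measurable_const.mul (hanti h).measurable)) ?_
  intro t ht
  have ht0 : 0 < t := ht
  by_cases ht1 : t < 1
  · refine bm_half (hf measurableSet_Ioi) (hg measurableSet_Ioi) (hfs t ht1) (hgs t ht1) ?_
    intro a (ha : t < f a) b (hb : t < g b)
    have := H a b
    have h2 : t ^ 2 < h ((a + b) / 2) ^ 2 := by nlinarith
    exact lt_of_pow_lt_pow_left₀ 2 (hh0 _) h2
  · have e1 : {x | t < f x} = ∅ := by
      ext x; simp; linarith [hf1 x]
    have e2 : {x | t < g x} = ∅ := by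
      ext x; simp; linarith [hg1 x]
    simp [e1, e2]

lemma pl_bdd {f g h : ℝ → ℝ} (hf : Measurable f) (hg : Measurable g)
    (hf0 : ∀ x, 0 ≤ f x) (hg0 : ∀ x, 0 ≤ g x) (hh0 : ∀ x, 0 ≤ h x) (hh : Measurable h)
    (hf1 : BddAbove (range f)) (hg1 : BddAbove (range g))
    (H : ∀ a b, f a * g b ≤ h ((a + b) / 2) ^ 2) :
    (∫⁻ x, ENNReal.ofReal (f x)) * (∫⁻ x, ENNReal.ofReal (g x))
      ≤ (∫⁻ x, ENNReal.ofReal (h x)) ^ 2 := by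
  set α := sSup (range f) with hα
  set β := sSup (range g) with hβ
  have hfα : ∀ x, f x ≤ α := fun x => le_csSup hf1 (mem_range_self x)
  have hgβ : ∀ x, g x ≤ β := fun x => le_csSup hg1 (mem_range_self x)
  rcases (le_trans (hf0 0) (hfα 0)).eq_or_lt with h0 | hα0
  · have : ∀ x, f x = 0 := fun x => le_antisymm (h0 ▸ hfα x) (hf0 x)
    simp [this]
  rcases (le_trans (hg0 0) (hgβ 0)).eq_or_lt with h0 | hβ0
  · have : ∀ x, g x = 0 := fun x => le_antisymm (h0 ▸ hgβ x) (hg0 x)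
    simp [this]
  set γ := √(α * β) with hγ
  have hγ0 : 0 < γ := Real.sqrt_pos.2 (mul_pos hα0 hβ0)
  have hγ2 : γ ^ 2 = α * β := Real.sq_sqrt (mul_pos hα0 hβ0).le
  have key := pl_norm (f := fun x => α⁻¹ * f x) (g := fun x => β⁻¹ * g x)
    (h := fun x => γ⁻¹ * h x)
    (hf.const_mul _) (hg.const_mul _) (fun x => mul_nonneg (inv_pos.2 hα0).le (hf0 x))
    (fun x => mul_nonneg (inv_pos.2 hβ0).le (hg0 x))
    (fun x => mul_nonneg (inv_pos.2 hγ0).le (hh0 x)) (hh.const_mul _)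
    (fun x => by
      rw [inv_mul_le_iff₀ hα0]; simpa using hfα x)
    (fun x => by
      rw [inv_mul_le_iff₀ hβ0]; simpa using hgβ x)
    (fun t ht => by
      obtain ⟨_, ⟨x, rfl⟩, hx⟩ := exists_lt_of_lt_csSup (range_nonempty f)
        (show α * t < sSup (range f) by rw [← hα]; nlinarith)
      exact ⟨x, by rw [lt_inv_mul_iff₀ hα0]; exact hx⟩)
    (fun t ht => by
      obtain ⟨_, ⟨x, rfl⟩, hx⟩ := exists_lt_of_lt_csSup (range_nonempty g)
        (show β * t < sSup (range g) by rw [← hβ]; nlinarith)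
      exact ⟨x, by rw [lt_inv_mul_iff₀ hβ0]; exact hx⟩)
    (fun a b => by
      have : (γ⁻¹ * h ((a + b) / 2)) ^ 2 = (α * β)⁻¹ * h ((a + b) / 2) ^ 2 := by
        rw [mul_pow, inv_pow, hγ2]
      rw [this, mul_inv]
      have := mul_le_mul_of_nonneg_left (H a b) (inv_pos.2 (mul_pos hα0 hβ0)).le
      rw [mul_inv] at this
      linarith)
  have hs : ∀ {k : ℝ → ℝ} {c : ℝ}, 0 < c → Measurable k →
      ∫⁻ x, ENNReal.ofReal (c⁻¹ * k x) = ENNReal.ofReal c⁻¹ * ∫⁻ x, ENNReal.ofReal (k x) := by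
    intro k c hc hk
    rw [← lintegral_const_mul _ hk.ennreal_ofReal]
    simp only [ENNReal.ofReal_mul (inv_pos.2 hc).le]
  rw [hs hα0 hf, hs hβ0 hg, hs hγ0 hh] at key
  generalize (∫⁻ x, ENNReal.ofReal (f x)) = I at key ⊢
  generalize (∫⁻ x, ENNReal.ofReal (g x)) = J at key ⊢
  generalize (∫⁻ x, ENNReal.ofReal (h x)) = L at key ⊢
  by_cases hL : L = ⊤
  · simp [hL]
  have hfin : 2 * (ENNReal.ofReal γ⁻¹ * L) ≠ ⊤ :=
    ENNReal.mul_ne_top (by simp) (ENNReal.mul_ne_top (by simp) hL)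
  have hI : I ≠ ⊤ := by
    intro h
    rw [h, ENNReal.mul_top (by simpa using hα0)] at key
    simp at key; exact hfin (by simpa using key)
  have hJ : J ≠ ⊤ := by
    intro h
    rw [h, ENNReal.mul_top (by simpa using hβ0)] at key
    simp at key; exact hfin (by simpa using key)
  lift I to NNReal using hI
  lift J to NNReal using hJ
  lift L to NNReal using hL
  rw [ENNReal.ofReal, ENNReal.ofReal, ENNReal.ofReal] at key
  norm_cast at key ⊢
  rw [← NNReal.coe_le_coe] at key ⊢
  push_cast at key ⊢
  rw [Real.coe_toNNReal _ (by positivity), Real.coe_toNNReal _ (by positivity),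
    Real.coe_toNNReal _ (by positivity)] at key
  have h4 : 4 * (α⁻¹ * I) * (β⁻¹ * J) ≤ (2 * (γ⁻¹ * L)) ^ 2 := by
    have hpos : 0 ≤ α⁻¹ * I + β⁻¹ * J := by positivity
    calc 4 * (α⁻¹ * I) * (β⁻¹ * J) ≤ (α⁻¹ * I + β⁻¹ * J) ^ 2 := by
          nlinarith [sq_nonneg (α⁻¹ * (I:ℝ) - β⁻¹ * J)]
      _ ≤ _ := by gcongr
  have h5 : (2 * (γ⁻¹ * (L:ℝ))) ^ 2 = 4 * ((α * β)⁻¹ * L ^ 2) := by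
    rw [mul_pow, mul_pow, inv_pow, hγ2]; ring
  rw [h5] at h4
  have h6 := mul_le_mul_of_nonneg_left h4 (mul_pos hα0 hβ0).le
  field_simp at h6
  linarith

lemma lintegral_exp_change (φ : ℝ → ENNReal) :
    ∫⁻ a, φ (Real.exp a) * ENNReal.ofReal (Real.exp a) = ∫⁻ s in Ioi 0, φ s := by
  have := lintegral_image_eq_lintegral_abs_deriv_mul (s := univ) (f := Real.exp)
    (f' := Real.exp) MeasurableSet.univ
    (fun x _ => (Real.hasDerivAt_exp x).hasDerivWithinAt) Real.exp_injective.injOn φ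
  rw [image_univ, Real.range_exp] at this
  rw [this, Measure.restrict_univ]
  congr 1
  ext a
  rw [abs_of_pos (Real.exp_pos a), mul_comm]

lemma lintegral_trunc {Φ : ℝ → ENNReal} (hΦ : Measurable Φ) :
    ∫⁻ a, Φ a = ⨆ k : ℕ, ∫⁻ a, min (Φ a) k := by
  rw [← lintegral_iSup (fun k => hΦ.min measurable_const)]
  · congr 1
    ext a
    have : ⨆ k : ℕ, min (Φ a) (k : ENNReal) = min (Φ a) (⨆ k : ℕ, (k : ENNReal)) := by
      exact (inf_iSup_eq (Φ a) (fun k : ℕ => (k : ENNReal))).symm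
    rw [this, ENNReal.iSup_natCast]; simp
  · intro k l hkl a
    have : (k : ENNReal) ≤ l := by exact_mod_cast hkl
    exact min_le_min le_rfl this

lemma half_line {φ ψ : ℝ → ENNReal} (hφ : Measurable φ) (hψ : Measurable ψ) {C : ℝ} (hC : 0 ≤ C)
    (H : ∀ s, 0 < s → ∀ t, 0 < t → φ s * ψ t ≤ ENNReal.ofReal (C * Real.exp (-(s * t)))) :
    (∫⁻ s in Ioi 0, φ s) * (∫⁻ t in Ioi 0, ψ t) ≤ ENNReal.ofReal (C * (π / 2)) := by
  rw [← lintegral_exp_change φ, ← lintegral_exp_change ψ]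
  have hm : ∀ {φ : ℝ → ENNReal}, Measurable φ →
      Measurable fun a => φ (Real.exp a) * ENNReal.ofReal (Real.exp a) := by
    intro φ hφ; fun_prop
  rw [lintegral_trunc (hm hφ), lintegral_trunc (hm hψ), ENNReal.iSup_mul]
  refine iSup_le fun k => ?_
  rw [ENNReal.mul_iSup]
  refine iSup_le fun l => ?_
  set f : ℝ → ℝ := fun a => (min (φ (Real.exp a) * ENNReal.ofReal (Real.exp a)) k).toReal
  set g : ℝ → ℝ := fun a => (min (ψ (Real.exp a) * ENNReal.ofReal (Real.exp a)) l).toReal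
  set h : ℝ → ℝ := fun c => √C * (Real.exp (-(1/2) * (Real.exp c) ^ 2) * Real.exp c)
  have hfb : ∀ {φ : ℝ → ENNReal} (k : ℕ), BddAbove (range (fun a => (min (φ (Real.exp a) * ENNReal.ofReal (Real.exp a)) (k:ENNReal)).toReal)) := by
    intro φ k
    refine ⟨k, ?_⟩
    rintro _ ⟨a, rfl⟩
    exact ENNReal.toReal_le_of_le_ofReal (by positivity) (by simp)
  have ht : ∀ (x : ENNReal) (k : ℕ), min x (k:ENNReal) ≠ ⊤ := fun x k =>
    ne_top_of_le_ne_top (ENNReal.natCast_ne_top k) (min_le_right _ _)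
  have key := pl_bdd (f := f) (g := g) (h := h) (by fun_prop) (by fun_prop)
    (fun x => ENNReal.toReal_nonneg) (fun x => ENNReal.toReal_nonneg)
    (fun x => by positivity) (by fun_prop) (hfb k) (hfb l) (fun a b => by
      simp only [f, g, h]
      rw [← ENNReal.toReal_mul]
      refine ENNReal.toReal_le_of_le_ofReal (by positivity) ?_
      calc _ ≤ (φ (Real.exp a) * ENNReal.ofReal (Real.exp a)) *
            (ψ (Real.exp b) * ENNReal.ofReal (Real.exp b)) := by
              gcongr <;> exact min_le_left _ _
        _ = (φ (Real.exp a) * ψ (Real.exp b)) * (ENNReal.ofReal (Real.exp a) *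
            ENNReal.ofReal (Real.exp b)) := by ring
        _ ≤ ENNReal.ofReal (C * Real.exp (-(Real.exp a * Real.exp b))) * (ENNReal.ofReal (Real.exp a) *
            ENNReal.ofReal (Real.exp b)) := by
              gcongr
              exact H _ (Real.exp_pos a) _ (Real.exp_pos b)
        _ = _ := by
              rw [← ENNReal.ofReal_mul (Real.exp_pos a).le, ← ENNReal.ofReal_mul (by positivity)]
              congr 1
              rw [mul_pow, Real.sq_sqrt hC, mul_pow, ← Real.exp_add, ← Real.exp_nat_mul,
                ← Real.exp_nat_mul, mul_assoc]
              congr 3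
              · push_cast
                rw [show 2 * ((a + b) / 2) = a + b by ring]
                ring
              · push_cast; ring)
  have e1 : ∀ a, ENNReal.ofReal (f a) = min (φ (Real.exp a) * ENNReal.ofReal (Real.exp a)) k :=
    fun a => ENNReal.ofReal_toReal (ht _ _)
  have e2 : ∀ a, ENNReal.ofReal (g a) = min (ψ (Real.exp a) * ENNReal.ofReal (Real.exp a)) l :=
    fun a => ENNReal.ofReal_toReal (ht _ _)
  simp only [e1, e2] at key
  refine key.trans (le_of_eq ?_)
  have e3 : ∫⁻ x, ENNReal.ofReal (h x) = ENNReal.ofReal (√C * (√(π / (1/2)) / 2)) := by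
    have : ∀ c, ENNReal.ofReal (h c) =
        (fun r => ENNReal.ofReal (√C * Real.exp (-(1/2) * r ^ 2))) (Real.exp c) *
          ENNReal.ofReal (Real.exp c) := by
      intro c
      simp only [h]
      rw [← ENNReal.ofReal_mul (by positivity), mul_assoc]
    simp only [this]
    rw [lintegral_exp_change (fun r => ENNReal.ofReal (√C * Real.exp (-(1/2) * r ^ 2))),
      ← integral_gaussian_Ioi, ← integral_const_mul, ofReal_integral_eq_lintegral_ofReal]
    · exact ((integrable_exp_neg_mul_sq (by norm_num)).const_mul _).integrableOn
    · exact Filter.Eventually.of_forall fun x => by positivity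
  rw [e3, ← ENNReal.ofReal_pow (by positivity)]
  congr 1
  rw [mul_pow, div_pow, Real.sq_sqrt hC, Real.sq_sqrt (by positivity)]
  ring

/-! ### The functional Santaló inequality (after Lehec) -/

/-- The functional Santaló inequality for centred functions in dimension `n`. -/
def SantaloProp (n : ℕ) : Prop :=
  ∀ f g : (Fin n → ℝ) → ENNReal, Measurable f → Measurable g →
    IsFiniteMeasure (volume.withDensity f) →
    (∀ i, Integrable (fun x : Fin n → ℝ => x i) (volume.withDensity f)) →
    (∀ i, ∫ x : Fin n → ℝ, x i ∂(volume.withDensity f) = 0) →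
    (∀ x y, f x * g y ≤ ENNReal.ofReal (Real.exp (-(dotProduct x y)))) →
    (∫⁻ x, f x) * (∫⁻ y, g y) ≤ ENNReal.ofReal ((2 * π) ^ n)

lemma lintegral_half {V : Type*} [MeasureSpace V] [SFinite (volume : Measure V)]
    {f : ℝ × V → ENNReal}
    (hf : Measurable f) (A : Set V) :
    ∫⁻ w in A, ∫⁻ s in Ioi (0:ℝ), f (s, w) = ∫⁻ p in (Ioi 0) ×ˢ A, f p := by
  rw [Measure.volume_eq_prod, ← Measure.prod_restrict, lintegral_prod_symm' f hf]

lemma withDensity_half {V : Type*} [MeasureSpace V] [SFinite (volume : Measure V)]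
    {f : ℝ × V → ENNReal}
    (hf : Measurable f) :
    (volume : Measure V).withDensity (fun w => ∫⁻ s in Ioi (0:ℝ), f (s, w)) =
      Measure.map Prod.snd ((volume.withDensity f).restrict {p : ℝ × V | 0 < p.1}) := by
  ext A hA
  rw [withDensity_apply _ hA, Measure.map_apply measurable_snd hA,
    Measure.restrict_apply (measurable_snd hA), withDensity_apply f
      ((measurable_snd hA).inter (measurableSet_lt measurable_const measurable_fst)),
    lintegral_half hf]
  congr 2
  ext p
  simp [and_comm]

lemma santalo_half {n : ℕ} (hS : SantaloProp n) {f g : ℝ × (Fin n → ℝ) → ENNReal}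
    (hf : Measurable f) (hg : Measurable g)
    (hfin : IsFiniteMeasure ((volume.withDensity f).restrict {p | 0 < p.1}))
    (hinte : ∀ i, Integrable (fun p : ℝ × (Fin n → ℝ) => p.2 i)
      ((volume.withDensity f).restrict {p | 0 < p.1}))
    (hzero : ∀ i, ∫ p : ℝ × (Fin n → ℝ), p.2 i
      ∂((volume.withDensity f).restrict {p | 0 < p.1}) = 0)
    (H : ∀ p q, f p * g q ≤ ENNReal.ofReal (Real.exp (-(p.1 * q.1 + dotProduct p.2 q.2)))) :
    (∫⁻ p in {p | 0 < p.1}, f p) * (∫⁻ q in {q | 0 < q.1}, g q) ≤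
      ENNReal.ofReal (π / 2 * (2 * π) ^ n) := by
  set F : (Fin n → ℝ) → ENNReal := fun w => ∫⁻ s in Ioi (0:ℝ), f (s, w) with hF
  set G : (Fin n → ℝ) → ENNReal := fun w => ∫⁻ s in Ioi (0:ℝ), g (s, w) with hG
  have hFm : Measurable F := Measurable.lintegral_prod_left' hf
  have hGm : Measurable G := Measurable.lintegral_prod_left' hg
  have hwd := withDensity_half hf
  have hI : ∀ {k : ℝ × (Fin n → ℝ) → ENNReal}, Measurable k →
      ∫⁻ p in {p | 0 < p.1}, k p = ∫⁻ w, ∫⁻ s in Ioi (0:ℝ), k (s, w) := by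
    intro k hk
    rw [← setLIntegral_univ (fun w => ∫⁻ s in Ioi (0:ℝ), k (s, w)), lintegral_half hk]
    congr 2
    ext p; simp
  have hπ : (0:ℝ) < π / 2 := by positivity
  have hmi : ∀ i, AEStronglyMeasurable (fun x : Fin n → ℝ => x i)
      (Measure.map Prod.snd ((volume.withDensity f).restrict {p : ℝ × (Fin n → ℝ) | 0 < p.1})) :=
    fun i => (continuous_apply i).aestronglyMeasurable
  have key := hS F (fun v => ENNReal.ofReal (π / 2)⁻¹ * G v) hFm (hGm.const_mul _)
    (by rw [hF, hwd]; infer_instance)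
    (fun i => by
      rw [hF, hwd]
      rw [integrable_map_measure (hmi i) measurable_snd.aemeasurable]
      exact hinte i)
    (fun i => by
      rw [hF, hwd]
      rw [integral_map measurable_snd.aemeasurable (hmi i)]
      exact hzero i)
    (fun w v => by
      have := half_line (φ := fun s => f (s, w)) (ψ := fun t => g (t, v)) (by fun_prop)
        (by fun_prop) (C := Real.exp (-(dotProduct w v))) (Real.exp_pos _).le
        (fun s _ t _ => by
          refine (H (s, w) (t, v)).trans (le_of_eq ?_)
          rw [← Real.exp_add]
          congr 2; ring)
      calc F w * (ENNReal.ofReal (π / 2)⁻¹ * G v) = ENNReal.ofReal (π / 2)⁻¹ * (F w * G v) := by ring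
        _ ≤ ENNReal.ofReal (π / 2)⁻¹ * ENNReal.ofReal (Real.exp (-(dotProduct w v)) * (π / 2)) := by
            gcongr
        _ = _ := by
            rw [← ENNReal.ofReal_mul (by positivity)]
            congr 1
            field_simp)
  rw [lintegral_const_mul _ hGm] at key
  rw [hI hf, hI hg, ENNReal.ofReal_mul (by positivity)]
  calc (∫⁻ w, F w) * ∫⁻ w, G w
      = ENNReal.ofReal (π / 2) * ((∫⁻ w, F w) * (ENNReal.ofReal (π / 2)⁻¹ * ∫⁻ w, G w)) := by
        have : ENNReal.ofReal (π / 2) * ENNReal.ofReal (π / 2)⁻¹ = 1 := by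
          rw [← ENNReal.ofReal_mul hπ.le, mul_inv_cancel₀ hπ.ne']; simp
        calc _ = (ENNReal.ofReal (π / 2) * ENNReal.ofReal (π / 2)⁻¹) * ((∫⁻ w, F w) * ∫⁻ w, G w) := by
              rw [this, one_mul]
          _ = _ := by ring
    _ ≤ _ := by gcongr

lemma exists_median (μ : Measure ℝ) [IsFiniteMeasure μ] [NullSingletonClass μ] :
    ∃ c, μ (Ioi c) = μ (Iio c) := by
  have hc : Continuous fun b => ∫ x in (0:ℝ)..b, (1:ℝ) ∂μ :=
    intervalIntegral.continuous_primitive (fun a b => intervalIntegrable_const) 0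
  have hval : ∀ b, ∫ x in (0:ℝ)..b, (1:ℝ) ∂μ = μ.real (Iic b) - μ.real (Iic 0) := by
    intro b
    rw [← intervalIntegral.integral_Iic_sub_Iic (by simp) (by simp)]
    simp
  have hc2 : Continuous fun b => μ.real (Iic b) := by
    have := hc.add (continuous_const (y := μ.real (Iic 0)))
    refine this.congr fun b => ?_
    simp [hval]
  have htop : Filter.Tendsto (fun b => μ.real (Iic b)) Filter.atTop (nhds (μ.real univ)) :=
    (ENNReal.tendsto_toReal (measure_ne_top μ _)).comp (tendsto_measure_Iic_atTop μ)
  have hbot : Filter.Tendsto (fun b => μ.real (Iic b)) Filter.atBot (nhds 0) := by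
    have := (ENNReal.tendsto_toReal (measure_ne_top μ _)).comp (tendsto_measure_Ici_atBot μ)
    have h2 := (tendsto_const_nhds (x := μ.real univ)).sub this
    have h3 : (μ univ).toReal = μ.real univ := rfl
    rw [h3, sub_self] at h2
    refine h2.congr fun b => ?_
    have h4 : μ.real (Iic b) = μ.real (Iio b) := measureReal_congr Iio_ae_eq_Iic.symm
    rw [h4, ← compl_Ici, measureReal_compl measurableSet_Ici]
    rfl
  have hM : 0 ≤ μ.real univ := measureReal_nonneg
  obtain ⟨c, hcc⟩ : ∃ c, μ.real (Iic c) = μ.real univ / 2 := by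
    rcases hM.eq_or_lt with h0 | hpos
    · refine ⟨0, le_antisymm ?_ ?_⟩
      · rw [← h0]; simpa using (measureReal_mono (subset_univ _)).trans h0.symm.le
      · rw [← h0]; simp
    · have h1 := (hbot.eventually (gt_mem_nhds (half_pos hpos))).exists
      have h2 := (htop.eventually (lt_mem_nhds (half_lt_self hpos))).exists
      obtain ⟨a, ha⟩ := h1
      obtain ⟨b, hb⟩ := h2
      exact mem_range_of_exists_le_of_exists_ge hc2 ⟨a, ha.le⟩ ⟨b, hb.le⟩
  refine ⟨c, ?_⟩
  rw [measure_congr (Iio_ae_eq_Iic (μ := μ) (a := c)), ← compl_Iic]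
  rw [← ENNReal.toReal_eq_toReal_iff' (measure_ne_top _ _) (measure_ne_top _ _)]
  change μ.real _ = μ.real _
  rw [measureReal_compl measurableSet_Iic, hcc]
  ring

lemma mp_scale {σ : ℝ} (hσ : σ = 1 ∨ σ = -1) : MeasurePreserving (fun s : ℝ => σ * s) := by
  rcases hσ with rfl | rfl
  · simp only [one_mul]; exact MeasurePreserving.id (volume : Measure ℝ)
  · simpa using Measure.measurePreserving_neg (volume : Measure ℝ)

lemma mp_S {n : ℕ} {σ : ℝ} (hσ : σ = 1 ∨ σ = -1) (c : ℝ) (ζ τ : Fin n → ℝ) :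
    MeasurePreserving (fun p : ℝ × (Fin n → ℝ) => (c + σ * p.1, (ζ + (σ * p.1) • τ) + p.2)) := by
  have h1 : MeasurePreserving (fun s : ℝ => c + σ * s) :=
    (measurePreserving_add_left volume c).comp (mp_scale hσ)
  rw [Measure.volume_eq_prod]
  refine MeasurePreserving.skew_product h1 (g := fun s w => (ζ + (σ * s) • τ) + w) ?_ ?_
  · fun_prop
  · exact Filter.Eventually.of_forall fun s => map_add_left_eq_self volume _

lemma mp_T {n : ℕ} {σ : ℝ} (hσ : σ = 1 ∨ σ = -1) (τ : Fin n → ℝ) :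
    MeasurePreserving (fun p : ℝ × (Fin n → ℝ) => (- dotProduct τ p.2 + σ * p.1, p.2)) := by
  have hd : Measurable fun v : Fin n → ℝ => dotProduct τ v := by
    unfold dotProduct; fun_prop
  have h : MeasurePreserving (fun p : (Fin n → ℝ) × ℝ => (p.1, - dotProduct τ p.1 + σ * p.2)) := by
    rw [Measure.volume_eq_prod]
    refine MeasurePreserving.skew_product (MeasurePreserving.id _)
      (g := fun v s => - dotProduct τ v + σ * s) ?_ ?_
    · simp only [Function.uncurry_def]; fun_prop
    · exact Filter.Eventually.of_forall fun v =>
        ((measurePreserving_add_left volume _).comp (mp_scale hσ)).map_eq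
  exact (Measure.measurePreserving_swap (μ := (volume : Measure (Fin n → ℝ)))
    (ν := (volume : Measure ℝ))).comp (h.comp (Measure.measurePreserving_swap
      (μ := (volume : Measure ℝ)) (ν := (volume : Measure (Fin n → ℝ)))))

lemma mp_withDensity {α β : Type*} [MeasurableSpace α] [MeasurableSpace β] {μ : Measure α}
    {ν : Measure β} {S : α → β} (hS : MeasurePreserving S μ ν) {f : β → ENNReal} (hf : Measurable f) :
    MeasurePreserving S (μ.withDensity (f ∘ S)) (ν.withDensity f) := by
  refine ⟨hS.measurable, ?_⟩
  ext A hA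
  rw [Measure.map_apply hS.measurable hA, withDensity_apply _ hA,
    withDensity_apply _ (hS.measurable hA)]
  exact hS.setLIntegral_comp_preimage hA hf

lemma santalo_sigma {n : ℕ} (hS : SantaloProp n) {σ : ℝ} (hσ : σ = 1 ∨ σ = -1)
    (c : ℝ) (ζ τ : Fin n → ℝ) {f g : ℝ × (Fin n → ℝ) → ENNReal}
    (hf : Measurable f) (hg : Measurable g)
    (hfin : IsFiniteMeasure (volume.withDensity f))
    (hinte : ∀ i, Integrable (fun p : ℝ × (Fin n → ℝ) => p.2 i - ζ i - (p.1 - c) * τ i)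
      (volume.withDensity f))
    (hzero : ∀ i, ∫ p in {p : ℝ × (Fin n → ℝ) | 0 < σ * (p.1 - c)},
      (p.2 i - ζ i - (p.1 - c) * τ i) ∂(volume.withDensity f) = 0)
    (H : ∀ p q, f ((c, ζ) + p) * g q ≤
      ENNReal.ofReal (Real.exp (-(p.1 * q.1 + dotProduct p.2 q.2)))) :
    (∫⁻ p in {p | 0 < σ * (p.1 - c)}, f p) *
      (∫⁻ q in {q : ℝ × (Fin n → ℝ) | 0 < σ * (q.1 + dotProduct τ q.2)}, g q) ≤
      ENNReal.ofReal (π / 2 * (2 * π) ^ n) := by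
  have hd : Measurable fun v : Fin n → ℝ => dotProduct τ v := by
    unfold dotProduct; fun_prop
  have hσ2 : σ * σ = 1 := by rcases hσ with rfl | rfl <;> norm_num
  set S := (fun p : ℝ × (Fin n → ℝ) => (c + σ * p.1, (ζ + (σ * p.1) • τ) + p.2)) with hSdef
  set T := (fun p : ℝ × (Fin n → ℝ) => (- dotProduct τ p.2 + σ * p.1, p.2)) with hTdef
  have mS : MeasurePreserving S := mp_S hσ c ζ τ
  have mT : MeasurePreserving T := mp_T hσ τ
  have hA : MeasurableSet {p : ℝ × (Fin n → ℝ) | 0 < σ * (p.1 - c)} :=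
    measurableSet_lt measurable_const (by fun_prop)
  have hB : MeasurableSet {q : ℝ × (Fin n → ℝ) | 0 < σ * (q.1 + dotProduct τ q.2)} :=
    measurableSet_lt measurable_const (by fun_prop)
  have preS : S ⁻¹' {p : ℝ × (Fin n → ℝ) | 0 < σ * (p.1 - c)} = {p | 0 < p.1} := by
    ext p
    simp only [hSdef, mem_preimage, mem_ofPred_eq, add_sub_cancel_left, ← mul_assoc, hσ2, one_mul]
  have preT : T ⁻¹' {q : ℝ × (Fin n → ℝ) | 0 < σ * (q.1 + dotProduct τ q.2)} = {p | 0 < p.1} := by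
    ext p
    simp only [hTdef, mem_preimage, mem_ofPred_eq, neg_add_cancel_comm, ← mul_assoc, hσ2, one_mul]
  have mS' := mp_withDensity mS hf
  have mS'' := mS'.restrict_preimage hA
  rw [preS] at mS''
  rw [← mS.setLIntegral_comp_preimage hA hf, ← mT.setLIntegral_comp_preimage hB hg, preS, preT]
  have hcomp : ∀ i (p : ℝ × (Fin n → ℝ)), p.2 i =
      ((fun p : ℝ × (Fin n → ℝ) => p.2 i - ζ i - (p.1 - c) * τ i) ∘ S) p := by
    intro i p
    simp [hSdef]; ring
  have hfin' : IsFiniteMeasure (volume.withDensity (f ∘ S)) := by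
    refine ⟨?_⟩
    rw [← preimage_univ (f := S), mS'.measure_preimage MeasurableSet.univ.nullMeasurableSet]
    exact measure_lt_top _ _
  have hmi : ∀ i, AEStronglyMeasurable (fun p : ℝ × (Fin n → ℝ) => p.2 i - ζ i - (p.1 - c) * τ i)
      ((volume.withDensity f).restrict {p | 0 < σ * (p.1 - c)}) := by
    intro i
    apply Measurable.aestronglyMeasurable
    fun_prop
  refine santalo_half hS (f := f ∘ S) (g := g ∘ T) (hf.comp mS.measurable) (hg.comp mT.measurable)
    inferInstance ?_ ?_ ?_
  · intro i
    rw [show (fun p : ℝ × (Fin n → ℝ) => p.2 i) = _ from funext (hcomp i)]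
    exact (mS''.integrable_comp (hmi i)).2 (hinte i).integrableOn
  · intro i
    rw [integral_congr_ae (Filter.Eventually.of_forall (hcomp i))]
    refine Eq.trans ?_ (hzero i)
    rw [← mS''.map_eq, integral_map mS''.measurable.aemeasurable]
    · rfl
    · rw [mS''.map_eq]; exact hmi i
  · intro p q
    have := H (σ * p.1, (σ * p.1) • τ + p.2) (T q)
    refine le_trans (le_of_eq ?_) (this.trans (le_of_eq ?_))
    · simp [hSdef, add_assoc]
    · congr 3
      simp only [hTdef, add_dotProduct, smul_dotProduct, smul_eq_mul]
      linear_combination (p.1 * q.1) * hσ2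

lemma santalo_exists {n : ℕ} (hS : SantaloProp n) {f : ℝ × (Fin n → ℝ) → ENNReal}
    (hf : Measurable f) (hfin : IsFiniteMeasure (volume.withDensity f))
    (h1 : Integrable (fun p : ℝ × (Fin n → ℝ) => p.1) (volume.withDensity f))
    (h2 : ∀ i, Integrable (fun p : ℝ × (Fin n → ℝ) => p.2 i) (volume.withDensity f)) :
    ∃ z : ℝ × (Fin n → ℝ), ∀ g : ℝ × (Fin n → ℝ) → ENNReal, Measurable g →
      (∀ p q, f (z + p) * g q ≤
        ENNReal.ofReal (Real.exp (-(p.1 * q.1 + dotProduct p.2 q.2)))) →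
      (∫⁻ p, f p) * (∫⁻ q, g q) ≤ ENNReal.ofReal ((2 * π) ^ (n + 1)) := by
  set ν := (volume : Measure (ℝ × (Fin n → ℝ))).withDensity f with hν
  have hline : ∀ a : ℝ, (volume : Measure (ℝ × (Fin n → ℝ))) {p | p.1 = a} = 0 := by
    intro a
    have : {p : ℝ × (Fin n → ℝ) | p.1 = a} = {a} ×ˢ univ := by ext p; simp
    rw [this, Measure.volume_eq_prod, Measure.prod_prod]; simp
  have hatom : NullSingletonClass (ν.map Prod.fst) := by
    refine ⟨fun a => ?_⟩
    rw [Measure.map_apply measurable_fst (measurableSet_singleton a)]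
    exact withDensity_absolutelyContinuous _ _ (hline a)
  obtain ⟨c, hc⟩ := exists_median (ν.map Prod.fst)
  rw [Measure.map_apply measurable_fst measurableSet_Ioi,
    Measure.map_apply measurable_fst measurableSet_Iio] at hc
  set A : Set (ℝ × (Fin n → ℝ)) := {p | 0 < 1 * (p.1 - c)} with hA
  set A' : Set (ℝ × (Fin n → ℝ)) := {p | 0 < (-1) * (p.1 - c)} with hA'
  have mA : MeasurableSet A := measurableSet_lt measurable_const (by fun_prop)
  have mA' : MeasurableSet A' := measurableSet_lt measurable_const (by fun_prop)
  have eA : Prod.fst ⁻¹' Ioi c = A := by ext p; simp [hA]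
  have eA' : Prod.fst ⁻¹' Iio c = A' := by ext p; simp [hA']
  rw [eA, eA'] at hc
  have hsplit : ∫⁻ p, f p = (∫⁻ p in A, f p) + ∫⁻ p in A', f p := by
    rw [← lintegral_union mA']
    · rw [← setLIntegral_univ f]
      refine (setLIntegral_congr (ae_eq_univ.2 (measure_mono_null ?_ (hline c)))).symm
      intro p hp
      simp only [hA, hA', mem_compl_iff, mem_union, mem_ofPred_eq, not_or, not_lt] at hp ⊢
      linarith [hp.1, hp.2]
    · rw [Set.disjoint_left]
      intro p hp hp'
      simp only [hA, hA', mem_ofPred_eq] at hp hp'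
      linarith
  have hνA : ν A = ∫⁻ p in A, f p := withDensity_apply _ mA
  have hνA' : ν A' = ∫⁻ p in A', f p := withDensity_apply _ mA'
  by_cases hm0 : ν A = 0
  · refine ⟨0, fun g hg _ => ?_⟩
    rw [hsplit, ← hνA, ← hνA', ← hc, hm0]
    simp
  have hm : 0 < ν.real A := ENNReal.toReal_pos hm0 (measure_ne_top _ _)
  have hmm : ν.real A' = ν.real A := by simp only [Measure.real, hc]
  have hi1 : Integrable (fun p : ℝ × (Fin n → ℝ) => p.1 - c) ν := h1.sub (integrable_const c)
  set P := ∫ p in A, (p.1 - c) ∂ν with hP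
  set Q := ∫ p in A', (p.1 - c) ∂ν with hQ
  have hP0 : 0 < P := by
    rw [hP, setIntegral_pos_iff_support_of_nonneg_ae]
    · refine lt_of_lt_of_le (pos_iff_ne_zero.2 hm0) (measure_mono fun p hp => ⟨?_, hp⟩)
      simp only [hA, mem_ofPred_eq] at hp
      simp only [Function.mem_support]; intro h; linarith
    · refine (ae_restrict_iff' mA).2 (Filter.Eventually.of_forall fun p hp => ?_)
      simp only [hA, mem_ofPred_eq] at hp
      simp only [Pi.zero_apply]; linarith
    · exact hi1.integrableOn
  have hQ0 : Q ≤ 0 := by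
    refine setIntegral_nonpos mA' fun p hp => ?_
    simp only [hA', mem_ofPred_eq] at hp
    linarith
  set Bp : Fin n → ℝ := fun i => ∫ p in A, p.2 i ∂ν
  set Bm : Fin n → ℝ := fun i => ∫ p in A', p.2 i ∂ν
  set τ : Fin n → ℝ := fun i => (Bp i - Bm i) / (P - Q)
  set ζ : Fin n → ℝ := fun i => (Bp i - P * τ i) / ν.real A
  have hinte : ∀ i, Integrable (fun p : ℝ × (Fin n → ℝ) => p.2 i - ζ i - (p.1 - c) * τ i) ν :=
    fun i => ((h2 i).sub (integrable_const _)).sub (hi1.mul_const _)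
  have hval : ∀ (i) (D : Set (ℝ × (Fin n → ℝ))), 
      ∫ p in D, (p.2 i - ζ i - (p.1 - c) * τ i) ∂ν
        = ∫ p in D, p.2 i ∂ν - ν.real D * ζ i - (∫ p in D, (p.1 - c) ∂ν) * τ i := by
    intro i D
    have i1 : IntegrableOn (fun p : ℝ × (Fin n → ℝ) => p.2 i - ζ i) D ν :=
      ((h2 i).sub (integrable_const _)).integrableOn
    have i2 : IntegrableOn (fun p : ℝ × (Fin n → ℝ) => (p.1 - c) * τ i) D ν :=
      (hi1.mul_const _).integrableOn
    rw [integral_sub i1 i2,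
      integral_sub (h2 i).integrableOn (integrable_const _).integrableOn, integral_mul_const]
    simp
  have hz1 : ∀ i, ν.real A * ζ i = Bp i - P * τ i := by
    intro i; simp only [ζ]; field_simp
  have hz2 : ∀ i, (P - Q) * τ i = Bp i - Bm i := by
    intro i
    have : P - Q ≠ 0 := by linarith
    simp only [τ]; field_simp
  refine ⟨(c, ζ), fun g hg H => ?_⟩
  have k1 := santalo_sigma hS (σ := 1) (Or.inl rfl) c ζ τ hf hg hfin hinte
    (fun i => by
      rw [hval i]
      have := hz1 i
      change Bp i - ν.real A * ζ i - P * τ i = 0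
      linarith) H
  have k2 := santalo_sigma hS (σ := -1) (Or.inr rfl) c ζ τ hf hg hfin hinte
    (fun i => by
      rw [hval i]
      have := hz1 i
      have := hz2 i
      change Bm i - ν.real A' * ζ i - Q * τ i = 0
      rw [hmm]
      linarith) H
  have hd : Measurable fun v : Fin n → ℝ => dotProduct τ v := by
    unfold dotProduct; fun_prop
  set D : Set (ℝ × (Fin n → ℝ)) := {q | 0 < 1 * (q.1 + dotProduct τ q.2)} with hD
  set D' : Set (ℝ × (Fin n → ℝ)) := {q | 0 < (-1) * (q.1 + dotProduct τ q.2)} with hD'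
  have mD : MeasurableSet D := measurableSet_lt measurable_const (by fun_prop)
  have mD' : MeasurableSet D' := measurableSet_lt measurable_const (by fun_prop)
  have hgsplit : ∫⁻ q, g q ≤ (∫⁻ q in D, g q) + ∫⁻ q in D', g q := by
    refine le_trans (le_of_eq ?_) (lintegral_union_le g D D')
    rw [← setLIntegral_univ g]
    refine (setLIntegral_congr (ae_eq_univ.2 (measure_mono_null
      (t := {q : ℝ × (Fin n → ℝ) | q.1 + dotProduct τ q.2 = 0}) ?_ ?_))).symm
    · intro p hp
      simp only [hD, hD', mem_compl_iff, mem_union, mem_ofPred_eq, not_or, not_lt] at hp ⊢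
      linarith [hp.1, hp.2]
    · have mT := mp_T (σ := 1) (Or.inl rfl) τ
      have hmeas : MeasurableSet {q : ℝ × (Fin n → ℝ) | q.1 + dotProduct τ q.2 = 0} :=
        measurableSet_eq_fun (by fun_prop) measurable_const
      rw [← mT.measure_preimage hmeas.nullMeasurableSet, ← hline 0]
      congr 1
      ext p; simp
  rw [← hνA] at k1
  rw [← hνA', ← hc] at k2
  rw [hsplit, ← hνA, ← hνA', ← hc]
  calc (ν A + ν A) * ∫⁻ q, g q ≤ (ν A + ν A) * ((∫⁻ q in D, g q) + ∫⁻ q in D', g q) := by gcongr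
    _ = 2 * (ν A * ∫⁻ q in D, g q) + 2 * (ν A * ∫⁻ q in D', g q) := by ring
    _ ≤ 2 * ENNReal.ofReal (π / 2 * (2 * π) ^ n) + 2 * ENNReal.ofReal (π / 2 * (2 * π) ^ n) := by
        gcongr
    _ = _ := by
        rw [← two_mul, ← mul_assoc, show (2:ENNReal) * 2 = ENNReal.ofReal 4 by
          rw [show (4:ℝ) = 2 * 2 by norm_num, ENNReal.ofReal_mul (by norm_num)]; simp,
          ← ENNReal.ofReal_mul (by norm_num)]
        congr 1
        ring

lemma santalo_zero : SantaloProp 0 := by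
  intro f g _ _ _ _ _ H
  have := H default default
  have hv : (volume : Measure (Fin 0 → ℝ)) univ = 1 := by
    rw [Measure.volume_pi_eq_dirac (0 : Fin 0 → ℝ)]; simp
  simp only [lintegral_unique, hv, mul_one]
  simp only [dotProduct, Finset.univ_eq_empty, Finset.sum_empty, neg_zero, Real.exp_zero,
    ENNReal.ofReal_one] at this
  rw [pow_zero, ENNReal.ofReal_one]
  convert this

lemma ofReal_integral_le_lint {α : Type*} [MeasurableSpace α] {μ : Measure α} {f : α → ℝ}
    (hf : Integrable f μ) : ENNReal.ofReal (∫ x, f x ∂μ) ≤ ∫⁻ x, ENNReal.ofReal (f x) ∂μ := by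
  rw [integral_eq_lintegral_pos_part_sub_lintegral_neg_part hf]
  exact (ENNReal.ofReal_le_ofReal (sub_le_self _ ENNReal.toReal_nonneg)).trans
    ENNReal.ofReal_toReal_le

lemma santalo_succ {n : ℕ} (hS : SantaloProp n) : SantaloProp (n + 1) := by
  intro f g hf hg hfin hinte hzero H
  by_cases hf0 : ∀ x, f x = 0
  · simp [hf0]
  push Not at hf0
  obtain ⟨x0, hx0⟩ := hf0
  have hmono : Monotone fun (k : ℕ) => (closedBall (0 : Fin (n+1) → ℝ) k).indicator g := by
    intro k l hkl
    refine indicator_le_indicator_of_subset (closedBall_subset_closedBall ?_) (fun _ => zero_le)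
    exact_mod_cast hkl
  have hsup : ∫⁻ y, g y = ⨆ k : ℕ, ∫⁻ y, (closedBall (0 : Fin (n+1) → ℝ) k).indicator g y := by
    rw [← lintegral_iSup (fun k => hg.indicator measurableSet_closedBall) hmono]
    congr 1
    ext y
    apply le_antisymm
    · obtain ⟨k, hk⟩ := exists_nat_ge ‖y‖
      refine le_iSup_of_le k ?_
      rw [indicator_of_mem (by simpa using hk)]
    · exact iSup_le fun k => indicator_le_self _ _ _
  rw [hsup, ENNReal.mul_iSup]
  refine iSup_le fun k => ?_
  set gk := (closedBall (0 : Fin (n+1) → ℝ) k).indicator g with hgk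
  have hgkm : Measurable gk := hg.indicator measurableSet_closedBall
  have hgkg : ∀ y, gk y ≤ g y := fun y => indicator_le_self _ _ _
  set e := MeasurableEquiv.piFinSuccAbove (fun _ : Fin (n+1) => ℝ) 0 with he
  have me : MeasurePreserving e.symm := (volume_preserving_piFinSuccAbove (fun _ : Fin (n+1) => ℝ) 0).symm
  have hes0 : ∀ p, e.symm p 0 = p.1 := fun p => by simp [he, MeasurableEquiv.piFinSuccAbove]
  have hess : ∀ p (i : Fin n), e.symm p i.succ = p.2 i := fun p i => by
    simp [he, MeasurableEquiv.piFinSuccAbove]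
  have hdot : ∀ p q, dotProduct (e.symm p) (e.symm q) = p.1 * q.1 + dotProduct p.2 q.2 := by
    intro p q
    simp only [dotProduct, Fin.sum_univ_succ, hes0, hess]
  have hadd : ∀ p q, e.symm (p + q) = e.symm p + e.symm q := by
    intro p q
    ext i
    refine Fin.cases ?_ (fun i => ?_) i
    · simp only [hes0, Pi.add_apply, Prod.fst_add]
    · simp only [hess, Pi.add_apply, Prod.snd_add]
  -- boundedness of the truncation
  have hcont : Continuous fun y : Fin (n+1) → ℝ => Real.exp (-(dotProduct x0 y)) := by
    unfold dotProduct; fun_prop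
  obtain ⟨M, hM⟩ := (isCompact_closedBall (0 : Fin (n+1) → ℝ) k).bddAbove_image hcont.continuousOn
  have hgkb : ∀ y, gk y ≤ (closedBall (0 : Fin (n+1) → ℝ) k).indicator
      (fun _ => ENNReal.ofReal M / f x0) y := by
    intro y
    by_cases hy : y ∈ closedBall (0 : Fin (n+1) → ℝ) k
    · rw [hgk, indicator_of_mem hy, indicator_of_mem hy]
      rw [ENNReal.le_div_iff_mul_le (Or.inl hx0) (Or.inr (by simp)), mul_comm]
      exact (H x0 y).trans (ENNReal.ofReal_le_ofReal (hM ⟨y, hy, rfl⟩))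
    · rw [hgk, indicator_of_notMem hy]; exact zero_le
  have hgkfin : ∫⁻ y, gk y < ⊤ := by
    refine lt_of_le_of_lt (lintegral_mono hgkb) ?_
    rw [lintegral_indicator measurableSet_closedBall, setLIntegral_const]
    exact ENNReal.mul_lt_top (ENNReal.div_lt_top (by simp) hx0) measure_closedBall_lt_top
  have hGm : Measurable (gk ∘ e.symm) := hgkm.comp e.symm.measurable
  have hGint : ∫⁻ p, (gk ∘ e.symm) p = ∫⁻ y, gk y := me.lintegral_comp hgkm
  have hGfin : IsFiniteMeasure (volume.withDensity (gk ∘ e.symm)) := by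
    refine ⟨?_⟩
    rw [withDensity_apply _ MeasurableSet.univ, setLIntegral_univ, hGint]
    exact hgkfin
  have hae : ∀ᵐ p ∂(volume.withDensity (gk ∘ e.symm)), ∀ i, ‖e.symm p i‖ ≤ k := by
    rw [ae_withDensity_iff hGm]
    refine Filter.Eventually.of_forall fun p hp i => ?_
    by_contra hcon
    apply hp
    simp only [Function.comp, hgk]
    apply indicator_of_notMem
    intro hmem
    rw [mem_closedBall_zero_iff] at hmem
    exact hcon ((norm_le_pi_norm _ i).trans hmem)
  obtain ⟨z, hz⟩ := santalo_exists hS hGm hGfin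
    (Integrable.of_bound (Measurable.aestronglyMeasurable (by fun_prop)) k (by
      filter_upwards [hae] with p hp
      rw [← hes0]; exact hp 0))
    (fun i => Integrable.of_bound (Measurable.aestronglyMeasurable (by fun_prop)) k (by
      filter_upwards [hae] with p hp
      rw [← hess]; exact hp i.succ))
  set z' := e.symm z with hz'
  have hzc : Measurable fun x : Fin (n+1) → ℝ => dotProduct z' x := by
    unfold dotProduct; fun_prop
  set h : (Fin (n+1) → ℝ) → ENNReal := fun x => f x * ENNReal.ofReal (Real.exp (dotProduct z' x))
    with hh
  have hhm : Measurable h := hf.mul (by fun_prop)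
  have key := hz (h ∘ e.symm) (hhm.comp e.symm.measurable) (by
    intro p q
    have h1 := H (e.symm q) (e.symm (z + p))
    have h2 : f (e.symm q) * gk (e.symm (z + p)) ≤
        ENNReal.ofReal (Real.exp (-(dotProduct (e.symm q) (e.symm (z + p))))) :=
      le_trans (by gcongr; exact hgkg _) h1
    simp only [Function.comp, hh]
    calc _ = (f (e.symm q) * gk (e.symm (z + p))) *
          ENNReal.ofReal (Real.exp (dotProduct z' (e.symm q))) := by ring
      _ ≤ ENNReal.ofReal (Real.exp (-(dotProduct (e.symm q) (e.symm (z + p))))) *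
          ENNReal.ofReal (Real.exp (dotProduct z' (e.symm q))) := by gcongr
      _ = _ := by
          rw [← ENNReal.ofReal_mul (Real.exp_pos _).le, ← Real.exp_add]
          congr 2
          rw [hadd, dotProduct_add, hdot q p, dotProduct_comm z', hz', dotProduct_comm p.2]
          ring)
  have hHint : ∫⁻ p, (h ∘ e.symm) p = ∫⁻ x, h x := me.lintegral_comp hhm
  rw [hGint, hHint] at key
  have hle : ∫⁻ x, f x ≤ ∫⁻ x, h x := by
    have hI : Integrable (fun x => dotProduct z' x) (volume.withDensity f) := by
      unfold dotProduct
      exact integrable_finsetSum _ fun i _ => (hinte i).const_mul _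
    have hI0 : ∫ x, dotProduct z' x ∂(volume.withDensity f) = 0 := by
      unfold dotProduct
      rw [integral_finsetSum _ fun i _ => (hinte i).const_mul _]
      simp [integral_const_mul, hzero]
    have h1 : ENNReal.ofReal (∫ x, (1 + dotProduct z' x) ∂(volume.withDensity f)) = ∫⁻ x, f x := by
      rw [integral_add (integrable_const _) hI, hI0]
      have h3 : ∫⁻ x, f x ≠ ⊤ := by
        have := measure_ne_top (volume.withDensity f) univ
        rwa [withDensity_apply _ MeasurableSet.univ, setLIntegral_univ] at this
      simp [Measure.real, h3]
    rw [← h1]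
    refine (ofReal_integral_le_lint ((integrable_const _).add hI)).trans ?_
    have h2 : ∫⁻ x, h x = ∫⁻ x, ENNReal.ofReal (Real.exp (dotProduct z' x)) ∂(volume.withDensity f) := by
      rw [lintegral_withDensity_eq_lintegral_mul _ hf (by fun_prop)]
      rfl
    rw [h2]
    refine lintegral_mono fun x => ENNReal.ofReal_le_ofReal ?_
    have := Real.add_one_le_exp (dotProduct z' x)
    simp only [Pi.add_apply]
    linarith
  calc (∫⁻ x, f x) * ∫⁻ y, gk y ≤ (∫⁻ x, h x) * ∫⁻ y, gk y := by gcongr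
    _ = (∫⁻ y, gk y) * (∫⁻ x, h x) := mul_comm _ _
    _ ≤ _ := key

theorem santalo_all (n : ℕ) : SantaloProp n := by
  induction n with
  | zero => exact santalo_zero
  | succ n ih => exact santalo_succ ih

/-! ### Application to convex bodies -/

lemma santalo_euc {n : ℕ} {F G : EuclideanSpace ℝ (Fin n) → ℝ} (hF : Measurable F)
    (hG : Measurable G) (hF0 : ∀ x, 0 ≤ F x) (hFi : Integrable F)
    (hinte : ∀ i, Integrable fun x => F x * x i) (hzero : ∀ i, ∫ x, F x * x i = 0)
    (H : ∀ x y, F x * G y ≤ Real.exp (-⟪x, y⟫)) :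
    (∫⁻ x, ENNReal.ofReal (F x)) * (∫⁻ y, ENNReal.ofReal (G y)) ≤ ENNReal.ofReal ((2 * π) ^ n) := by
  have me := PiLp.volume_preserving_toLp (Fin n)
  have mm : MeasurableEmbedding (@WithLp.toLp 2 (Fin n → ℝ)) :=
    (MeasurableEquiv.toLp 2 (Fin n → ℝ)).measurableEmbedding
  have mt : Measurable (@WithLp.toLp 2 (Fin n → ℝ)) := me.measurable
  have e1 : ∫⁻ x : Fin n → ℝ, ENNReal.ofReal (F (WithLp.toLp 2 x)) = ∫⁻ x, ENNReal.ofReal (F x) :=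
    me.lintegral_comp (f := fun x => ENNReal.ofReal (F x)) (by fun_prop)
  have e2 : ∫⁻ x : Fin n → ℝ, ENNReal.ofReal (G (WithLp.toLp 2 x)) = ∫⁻ x, ENNReal.ofReal (G x) :=
    me.lintegral_comp (f := fun x => ENNReal.ofReal (G x)) (by fun_prop)
  have hm1 : Measurable fun x : Fin n → ℝ => F (WithLp.toLp 2 x) := hF.comp mt
  have hm2 : Measurable fun x : Fin n → ℝ => G (WithLp.toLp 2 x) := hG.comp mt
  rw [← e1, ← e2]
  refine santalo_all n _ _ hm1.ennreal_ofReal hm2.ennreal_ofReal ⟨?_⟩ ?_ ?_ ?_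
  · rw [withDensity_apply _ MeasurableSet.univ, setLIntegral_univ, e1]
    exact hFi.lintegral_lt_top
  · intro i
    rw [integrable_withDensity_iff_integrable_smul' hm1.ennreal_ofReal (by simp)]
    have := (me.integrable_comp_emb mm).2 (hinte i)
    refine this.congr (Filter.Eventually.of_forall fun x => ?_)
    simp [hF0]
  · intro i
    rw [integral_withDensity_eq_integral_toReal_smul hm1.ennreal_ofReal (by simp)]
    have := me.integral_comp mm (fun x => F x * x i)
    rw [hzero i] at this
    rw [← this]
    refine integral_congr_ae (Filter.Eventually.of_forall fun x => ?_)
    simp [hF0]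
  · intro x y
    rw [← ENNReal.ofReal_mul (hF0 _)]
    refine ENNReal.ofReal_le_ofReal ((H _ _).trans (le_of_eq ?_))
    rw [EuclideanSpace.inner_toLp_toLp, dotProduct_comm]
    simp

lemma exp_layer {a : ℝ} (ha : 0 ≤ a) : ENNReal.ofReal (Real.exp (-a ^ 2 / 2)) =
    ∫⁻ t in Ioi a, ENNReal.ofReal (t * Real.exp (-t ^ 2 / 2)) := by
  have hd : ∀ x ∈ Ici a, HasDerivAt (fun t : ℝ => -Real.exp (-t ^ 2 / 2))
      (x * Real.exp (-x ^ 2 / 2)) x := by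
    intro x _
    have h1 : HasDerivAt (fun t : ℝ => -t ^ 2 / 2) (-x) x := by
      have := ((hasDerivAt_pow 2 x).neg).div_const 2
      exact this.congr_deriv (by simp; ring)
    exact h1.exp.neg.congr_deriv (by ring)
  have hpos : ∀ x ∈ Ioi a, 0 ≤ x * Real.exp (-x ^ 2 / 2) := fun x hx =>
    mul_nonneg (ha.trans (le_of_lt hx)) (Real.exp_pos _).le
  have ht : Filter.Tendsto (fun t : ℝ => -Real.exp (-t ^ 2 / 2)) Filter.atTop (nhds 0) := by
    rw [← neg_zero]
    refine Filter.Tendsto.neg (Real.tendsto_exp_atBot.comp ?_)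
    have : Filter.Tendsto (fun t : ℝ => t ^ 2 / 2) Filter.atTop Filter.atTop :=
      (Filter.tendsto_pow_atTop two_ne_zero).atTop_div_const two_pos
    refine (Filter.tendsto_neg_atTop_atBot.comp this).congr fun t => ?_
    simp [neg_div]
  have hi := integrableOn_Ioi_deriv_of_nonneg' hd hpos ht
  have hI := integral_Ioi_of_hasDerivAt_of_nonneg' hd hpos ht
  rw [← ofReal_integral_eq_lintegral_ofReal hi
    ((ae_restrict_iff' measurableSet_Ioi).2 (Filter.Eventually.of_forall hpos)), hI]
  simp

/-- The constant of the scaling lemma. -/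
def scaleConst (n d : ℕ) : ENNReal :=
  ∫⁻ t in Ioi (0 : ℝ), ENNReal.ofReal (t * Real.exp (-t ^ 2 / 2)) * ENNReal.ofReal (t ^ (n + d))

lemma scaleConst_ne_top (n d : ℕ) : scaleConst n d ≠ ⊤ := by
  have h := integrableOn_rpow_mul_exp_neg_mul_sq (b := 1/2) (by norm_num)
    (s := ((n + d + 1 : ℕ) : ℝ)) (lt_of_lt_of_le (by norm_num) (Nat.cast_nonneg _))
  refine ne_of_lt (lt_of_eq_of_lt ?_ h.lintegral_lt_top)
  unfold scaleConst
  refine setLIntegral_congr_fun measurableSet_Ioi fun t ht => ?_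
  have ht' : (0:ℝ) < t := ht
  rw [← ENNReal.ofReal_mul (by positivity), Real.rpow_natCast]
  congr 1
  rw [show -(1/2) * t ^ 2 = -t ^ 2 / 2 by ring]
  ring

lemma scaling_aux {n d : ℕ} {γ : EuclideanSpace ℝ (Fin n) → ℝ}
    (hhom : ∀ t : ℝ, 0 < t → ∀ x, γ (t • x) = t * γ x)
    {w : EuclideanSpace ℝ (Fin n) → ENNReal} (hw : Measurable w) (hγm : Measurable γ)
    (hwhom : ∀ t : ℝ, 0 < t → ∀ x, w (t • x) = ENNReal.ofReal (t ^ d) * w x) {t : ℝ} (ht : 0 < t) :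
    ∫⁻ x in {x | γ x < t}, w x = ENNReal.ofReal (t ^ (n + d)) * ∫⁻ x in {x | γ x < 1}, w x := by
  have hms : ∀ s : ℝ, MeasurableSet {x | γ x < s} := fun s => measurableSet_lt hγm measurable_const
  have h1 := Measure.map_addHaar_smul (volume : Measure (EuclideanSpace ℝ (Fin n))) ht.ne'
  have hmeas : Measurable ({x | γ x < t}.indicator w) := hw.indicator (hms t)
  have h2 : ∫⁻ x, ({x | γ x < t}.indicator w) (t • x) =
      ENNReal.ofReal ((t ^ n)⁻¹) * ∫⁻ x in {x | γ x < t}, w x := by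
    rw [← lintegral_map (f := {x | γ x < t}.indicator w) hmeas (measurable_const_smul t), h1,
      lintegral_smul_measure, lintegral_indicator (hms t)]
    rw [abs_of_pos (by positivity)]
    simp
  have h3 : ∫⁻ x, ({x | γ x < t}.indicator w) (t • x) =
      ENNReal.ofReal (t ^ d) * ∫⁻ x in {x | γ x < 1}, w x := by
    rw [← lintegral_const_mul _ hw, ← lintegral_indicator (hms 1)]
    congr 1
    ext x
    have : γ (t • x) < t ↔ γ x < 1 := by
      rw [hhom t ht]
      constructor <;> intro h <;> nlinarith
    by_cases hx : γ x < 1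
    · rw [indicator_of_mem (by exact this.2 hx), indicator_of_mem (by exact hx), hwhom t ht]
    · rw [indicator_of_notMem (by exact fun h => hx (this.1 h)), indicator_of_notMem (by exact hx)]
  rw [h3] at h2
  rw [pow_add, ENNReal.ofReal_mul (by positivity), mul_assoc, h2, ← mul_assoc,
    ← ENNReal.ofReal_mul (by positivity), mul_inv_cancel₀ (by positivity)]
  simp

lemma scaling {n d : ℕ} {γ : EuclideanSpace ℝ (Fin n) → ℝ} (hγ0 : ∀ x, 0 ≤ γ x)
    (hhom : ∀ t : ℝ, 0 < t → ∀ x, γ (t • x) = t * γ x)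
    {w : EuclideanSpace ℝ (Fin n) → ENNReal} (hw : Measurable w) (hγm : Measurable γ)
    (hwhom : ∀ t : ℝ, 0 < t → ∀ x, w (t • x) = ENNReal.ofReal (t ^ d) * w x) :
    ∫⁻ x, ENNReal.ofReal (Real.exp (-(γ x) ^ 2 / 2)) * w x =
      scaleConst n d * ∫⁻ x in {x | γ x < 1}, w x := by
  have hms : ∀ s : ℝ, MeasurableSet {x | γ x < s} := fun s => measurableSet_lt hγm measurable_const
  have hmk : Measurable fun t : ℝ => ENNReal.ofReal (t * Real.exp (-t ^ 2 / 2)) := by fun_prop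
  set Q : EuclideanSpace ℝ (Fin n) × ℝ → ENNReal := {p : EuclideanSpace ℝ (Fin n) × ℝ | γ p.1 < p.2}.indicator
      (fun p => ENNReal.ofReal (p.2 * Real.exp (-p.2 ^ 2 / 2)) * w p.1) with hQ
  have hM : Measurable Q := by
    rw [hQ]
    refine Measurable.indicator (by fun_prop) ?_
    exact measurableSet_lt (by fun_prop) (by fun_prop)
  calc ∫⁻ x, ENNReal.ofReal (Real.exp (-(γ x) ^ 2 / 2)) * w x
      = ∫⁻ x, ∫⁻ t in Ioi (0:ℝ), Q (x, t) := by
        congr 1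
        ext x
        rw [exp_layer (hγ0 x), ← lintegral_mul_const _ hmk, ← lintegral_indicator measurableSet_Ioi,
          ← lintegral_indicator measurableSet_Ioi]
        congr 1
        ext t
        by_cases h : γ x < t
        · rw [indicator_of_mem (by exact h), indicator_of_mem (by exact (hγ0 x).trans_lt h), hQ,
            indicator_of_mem (by exact h)]
        · rw [indicator_of_notMem (by exact h)]
          by_cases h0 : t ∈ Ioi (0:ℝ)
          · rw [indicator_of_mem h0, hQ, indicator_of_notMem (by exact h)]
          · rw [indicator_of_notMem h0]
    _ = ∫⁻ t in Ioi (0:ℝ), ∫⁻ x, Q (x, t) :=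
        lintegral_lintegral_swap hM.aemeasurable
    _ = ∫⁻ t in Ioi (0:ℝ), (ENNReal.ofReal (t * Real.exp (-t ^ 2 / 2)) *
          ENNReal.ofReal (t ^ (n + d))) * ∫⁻ x in {x | γ x < 1}, w x := by
        refine setLIntegral_congr_fun measurableSet_Ioi fun t ht => ?_
        rw [mul_assoc, ← scaling_aux hhom hw hγm hwhom ht, ← lintegral_const_mul _ hw,
          ← lintegral_indicator (hms t)]
        rfl
    _ = _ := by
        rw [lintegral_mul_const _ (by fun_prop)]
        rfl

lemma gauss_ball (n : ℕ) : scaleConst n 0 * volume (ball (0 : EuclideanSpace ℝ (Fin n)) 1) =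
    ENNReal.ofReal ((2 * π) ^ ((n : ℝ) / 2)) := by
  have h := scaling (n := n) (d := 0) (γ := fun x => ‖x‖) (fun x => norm_nonneg x)
    (fun t ht x => by rw [norm_smul, Real.norm_of_nonneg ht.le]) (w := fun _ => 1)
    measurable_const measurable_norm (fun t _ x => by simp)
  have h2 := GaussianFourier.integral_rexp_neg_mul_sq_norm (V := EuclideanSpace ℝ (Fin n))
    (b := 1/2) (by norm_num)
  have hpos : 0 < (2 * π) ^ ((n : ℝ) / 2) := by positivity
  have h3 : ∫ v : EuclideanSpace ℝ (Fin n), rexp (-(1/2) * ‖v‖ ^ 2) = (2 * π) ^ ((n : ℝ) / 2) := by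
    rw [h2]; congr 1
    · ring
    · simp
  have hi : Integrable fun v : EuclideanSpace ℝ (Fin n) => rexp (-(1/2) * ‖v‖ ^ 2) := by
    by_contra hc
    rw [integral_undef hc] at h3
    exact hpos.ne h3
  rw [← h3, ofReal_integral_eq_lintegral_ofReal hi
    (Filter.Eventually.of_forall fun v => (Real.exp_pos _).le)]
  have hset : {x : EuclideanSpace ℝ (Fin n) | ‖x‖ < 1} = ball 0 1 := by ext x; simp
  simp only [mul_one, lintegral_const, Measure.restrict_apply MeasurableSet.univ, univ_inter,
    hset, one_mul] at h
  rw [← h]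
  congr 1
  ext x
  congr 2
  ring

/-- Abstract Santaló: `γ` the gauge of a centred body, `h` its polar gauge. -/
lemma santalo_gauge {n : ℕ} {γ h : EuclideanSpace ℝ (Fin n) → ℝ} (hγ0 : ∀ x, 0 ≤ γ x)
    (hγhom : ∀ t : ℝ, 0 < t → ∀ x, γ (t • x) = t * γ x) (hγm : Measurable γ)
    (hh0 : ∀ x, 0 ≤ h x)
    (hhhom : ∀ t : ℝ, 0 < t → ∀ x, h (t • x) = t * h x) (hhm : Measurable h)
    (hle : ∀ x y, ⟪x, y⟫ ≤ γ x * h y)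
    (hbdd : Bornology.IsBounded {x | γ x < 1})
    (hvol : volume {x | γ x < 1} = volume (ball (0 : EuclideanSpace ℝ (Fin n)) 1))
    (hcent : ∀ i, ∫ x in {x | γ x < 1}, x i = 0) :
    volume {y | h y < 1} ≤ volume (ball (0 : EuclideanSpace ℝ (Fin n)) 1) := by
  have hms : MeasurableSet {x | γ x < 1} := measurableSet_lt hγm measurable_const
  have hF := scaling (d := 0) hγ0 hγhom (w := fun _ => 1) measurable_const hγm
    (fun t _ x => by simp)
  have hG := scaling (d := 0) hh0 hhhom (w := fun _ => 1) measurable_const hhm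
    (fun t _ x => by simp)
  simp only [mul_one, lintegral_const, Measure.restrict_apply MeasurableSet.univ, univ_inter,
    one_mul] at hF hG
  set F : EuclideanSpace ℝ (Fin n) → ℝ := fun x => Real.exp (-(γ x) ^ 2 / 2) with hFdef
  have hFm : Measurable F := by fun_prop
  have hvt : volume (ball (0 : EuclideanSpace ℝ (Fin n)) 1) ≠ ⊤ := measure_ball_lt_top.ne
  have hv0 : volume (ball (0 : EuclideanSpace ℝ (Fin n)) 1) ≠ 0 :=
    (measure_ball_pos _ _ one_pos).ne'
  have hFi : Integrable F := by
    refine ⟨hFm.aestronglyMeasurable, ?_⟩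
    rw [hasFiniteIntegral_iff_ofReal (Filter.Eventually.of_forall fun v => (Real.exp_pos _).le), hF,
      hvol]
    exact ENNReal.mul_lt_top (scaleConst_ne_top n 0).lt_top hvt.lt_top
  -- integrals of linear functions
  have hxi : ∀ i, IntegrableOn (fun x : EuclideanSpace ℝ (Fin n) => x i) {x | γ x < 1} := by
    intro i
    obtain ⟨R, hR⟩ := hbdd.exists_norm_le
    refine Measure.integrableOn_of_bounded (M := R) (by rw [hvol]; exact hvt)
      (Measurable.aestronglyMeasurable (by fun_prop)) ?_
    refine (ae_restrict_iff' hms).2 (Filter.Eventually.of_forall fun x hx => ?_)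
    exact (PiLp.norm_apply_le x i).trans (hR x hx)
  have hlin : ∀ s : ℝ, ∀ i, ∫⁻ x, ENNReal.ofReal (F x) * ENNReal.ofReal (s * x i) =
      scaleConst n 1 * ∫⁻ x in {x | γ x < 1}, ENNReal.ofReal (s * x i) := by
    intro s i
    refine scaling (d := 1) hγ0 hγhom (w := fun x => ENNReal.ofReal (s * x i)) (by fun_prop) hγm ?_
    intro t ht x
    rw [← ENNReal.ofReal_mul (by positivity)]
    congr 1
    simp only [PiLp.smul_apply, smul_eq_mul]
    ring
  have hmul : ∀ s : ℝ, ∀ i x, ENNReal.ofReal (s * (F x * x i)) =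
      ENNReal.ofReal (F x) * ENNReal.ofReal (s * x i) := by
    intro s i x
    rw [← ENNReal.ofReal_mul (Real.exp_pos _).le]
    congr 1
    ring
  have hfin : ∀ s : ℝ, ∀ i, ∫⁻ x, ENNReal.ofReal (s * (F x * x i)) < ⊤ := by
    intro s i
    simp only [hmul, hlin]
    exact ENNReal.mul_lt_top (scaleConst_ne_top n 1).lt_top ((hxi i).const_mul s).lintegral_lt_top
  have hpm : ∀ i, Measurable fun x => F x * x i := fun i => by fun_prop
  have hinte : ∀ i, Integrable fun x => F x * x i := by
    intro i
    refine ⟨(hpm i).aestronglyMeasurable, ?_⟩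
    rw [hasFiniteIntegral_iff_norm]
    have hb : ∀ x, ENNReal.ofReal ‖F x * x i‖ ≤
        ENNReal.ofReal (1 * (F x * x i)) + ENNReal.ofReal (-1 * (F x * x i)) := by
      intro x
      rcases le_total 0 (F x * x i) with h0 | h0
      · rw [Real.norm_of_nonneg h0, one_mul]; exact le_self_add
      · rw [Real.norm_of_nonpos h0, neg_one_mul]; exact le_add_self
    refine (lintegral_mono hb).trans_lt ?_
    rw [lintegral_add_left (by fun_prop)]
    exact ENNReal.add_lt_top.2 ⟨hfin 1 i, hfin (-1) i⟩
  have hzero : ∀ i, ∫ x, F x * x i = 0 := by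
    intro i
    rw [integral_eq_lintegral_pos_part_sub_lintegral_neg_part (hinte i)]
    have h0 := hcent i
    rw [integral_eq_lintegral_pos_part_sub_lintegral_neg_part (hxi i)] at h0
    have h1 := hlin 1 i
    have h2 := hlin (-1) i
    simp only [← hmul] at h1 h2
    simp only [one_mul, neg_one_mul] at h1 h2
    rw [h1, h2, ENNReal.toReal_mul, ENNReal.toReal_mul, ← mul_sub, h0, mul_zero]
  have key := santalo_euc (F := F) (G := fun y => Real.exp (-(h y) ^ 2 / 2)) hFm (by fun_prop)
    (fun x => (Real.exp_pos _).le) hFi hinte hzero (by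
      intro x y
      rw [hFdef, ← Real.exp_add]
      refine Real.exp_le_exp.2 ?_
      nlinarith [hle x y, sq_nonneg (γ x - h y)])
  rw [hF, hG, hvol, gauss_ball] at key
  have hC := gauss_ball n
  have hπ : ENNReal.ofReal ((2 * π) ^ n) = ENNReal.ofReal ((2 * π) ^ ((n : ℝ) / 2)) *
      (scaleConst n 0 * volume (ball (0 : EuclideanSpace ℝ (Fin n)) 1)) := by
    rw [hC, ← ENNReal.ofReal_mul (by positivity), ← Real.rpow_add (by positivity), add_halves,
      Real.rpow_natCast]
  have hg0 : ENNReal.ofReal ((2 * π) ^ ((n : ℝ) / 2)) ≠ 0 := by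
    rw [Ne, ENNReal.ofReal_eq_zero, not_le]; positivity
  have hc0 : scaleConst n 0 ≠ 0 := by
    intro h0; rw [h0, zero_mul] at hC; exact hg0 hC.symm
  rw [hπ, ENNReal.mul_le_mul_iff_right hg0 ENNReal.ofReal_ne_top,
    ENNReal.mul_le_mul_iff_right hc0 (scaleConst_ne_top n 0)] at key
  exact key

/-- Polar coordinates for the volume of a star body. -/
lemma polar_vol {n : ℕ} (hn : 1 ≤ n) {h : EuclideanSpace ℝ (Fin n) → ℝ}
    (hhom : ∀ t : ℝ, 0 < t → ∀ x, h (t • x) = t * h x) (hhm : Measurable h)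
    (hpos : ∀ u : sphere (0 : EuclideanSpace ℝ (Fin n)) 1, 0 < h u) :
    ∫⁻ u : sphere (0 : EuclideanSpace ℝ (Fin n)) 1, ENNReal.ofReal ((h u)⁻¹ ^ n / n)
      ∂((volume : Measure (EuclideanSpace ℝ (Fin n))).toSphere) ≤ volume {y | h y < 1} := by
  have mp := Measure.measurePreserving_homeomorphUnitSphereProd
    (volume : Measure (EuclideanSpace ℝ (Fin n)))
  set A : Set (sphere (0 : EuclideanSpace ℝ (Fin n)) 1 × Ioi (0:ℝ)) :=
    {p | p.2.1 * h p.1 < 1} with hA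
  have hAm : MeasurableSet A := measurableSet_lt (by fun_prop) measurable_const
  have h1 := mp.measure_preimage hAm.nullMeasurableSet
  have h2 : volume.comap (Subtype.val : ({0}ᶜ : Set (EuclideanSpace ℝ (Fin n))) → EuclideanSpace ℝ (Fin n))
      (homeomorphUnitSphereProd (EuclideanSpace ℝ (Fin n)) ⁻¹' A) ≤ volume {y | h y < 1} := by
    rw [(MeasurableEmbedding.subtype_coe (measurableSet_singleton _).compl).comap_apply]
    refine measure_mono ?_
    rintro _ ⟨x, hx, rfl⟩
    have hx0 : (x : EuclideanSpace ℝ (Fin n)) ≠ 0 := x.2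
    have hx' : ‖(x : EuclideanSpace ℝ (Fin n))‖ * h (‖(x : EuclideanSpace ℝ (Fin n))‖⁻¹ • (x : EuclideanSpace ℝ (Fin n))) < 1 := by
      simpa [hA] using hx
    rw [← hhom _ (norm_pos_iff.2 hx0), smul_inv_smul₀ (norm_ne_zero_iff.2 hx0)] at hx'
    exact hx'
  rw [h1] at h2
  refine le_trans (le_of_eq ?_) h2
  rw [Measure.prod_apply hAm]
  refine lintegral_congr fun u => ?_
  have hu := hpos u
  have hs : Prod.mk u ⁻¹' A = Iio ⟨(h u)⁻¹, inv_pos.2 hu⟩ := by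
    ext r
    simp only [hA, mem_preimage, mem_ofPred_eq, mem_Iio, ← Subtype.coe_lt_coe]
    rw [lt_inv_comm₀ r.2 hu, ← one_div, lt_div_iff₀ r.2, mul_comm]
  rw [hs, Measure.volumeIoiPow_apply_Iio]
  have hd : Module.finrank ℝ (EuclideanSpace ℝ (Fin n)) - 1 + 1 = n := by
    simp; omega
  congr 1
  have hd' : ((Module.finrank ℝ (EuclideanSpace ℝ (Fin n)) - 1 : ℕ) : ℝ) + 1 = n := by
    exact_mod_cast hd
  rw [hd, hd']

section Support
variable {n : ℕ} {K : Set (EuclideanSpace ℝ (Fin n))}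

lemma supp_ge (hK : IsCompact K) {x : EuclideanSpace ℝ (Fin n)} (hx : x ∈ K)
    (u : EuclideanSpace ℝ (Fin n)) : ⟪x, u⟫ ≤ supp K u :=
  le_csSup (hK.bddAbove_image (Continuous.continuousOn (by fun_prop))) ⟨x, hx, rfl⟩

lemma supp_le (hne : K.Nonempty) {u : EuclideanSpace ℝ (Fin n)} {c : ℝ}
    (h : ∀ x ∈ K, ⟪x, u⟫ ≤ c) : supp K u ≤ c := by
  refine csSup_le (hne.image _) ?_
  rintro _ ⟨x, hx, rfl⟩
  exact h x hx

lemma supp_smul (hK : IsCompact K) (hne : K.Nonempty) {t : ℝ} (ht : 0 < t)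
    (u : EuclideanSpace ℝ (Fin n)) : supp K (t • u) = t * supp K u := by
  apply le_antisymm
  · refine supp_le hne fun x hx => ?_
    rw [inner_smul_right]
    exact mul_le_mul_of_nonneg_left (supp_ge hK hx u) ht.le
  · rw [mul_comm, ← le_div_iff₀ ht]
    refine supp_le hne fun x hx => ?_
    rw [le_div_iff₀ ht, mul_comm, ← inner_smul_right]
    exact supp_ge hK hx _

lemma continuous_supp (hK : IsCompact K) : Continuous (supp K) := by
  unfold supp
  exact hK.continuous_sSup (f := fun u x => ⟪x, u⟫) (by
    change Continuous fun p : EuclideanSpace ℝ (Fin n) × EuclideanSpace ℝ (Fin n) => ⟪p.2, p.1⟫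
    fun_prop)

lemma supp_pos (hK : IsCompact K) {x : EuclideanSpace ℝ (Fin n)} (hx : x ∈ interior K)
    {u : EuclideanSpace ℝ (Fin n)} (hu : u ≠ 0) : 0 < supp K u - ⟪x, u⟫ := by
  obtain ⟨r, hr, hb⟩ := Metric.mem_nhds_iff.1 (mem_interior_iff_mem_nhds.1 hx)
  have hn : 0 < ‖u‖ := norm_pos_iff.2 hu
  have hm : x + (r / 2 / ‖u‖) • u ∈ K := by
    apply hb
    rw [mem_ball, dist_eq_norm, add_sub_cancel_left, norm_smul, Real.norm_of_nonneg (by positivity),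
      div_mul_cancel₀ _ hn.ne']
    linarith
  have h1 := supp_ge hK hm u
  rw [inner_add_left, inner_smul_left, real_inner_self_eq_norm_sq] at h1
  have : 0 < r / 2 / ‖u‖ * ‖u‖ ^ 2 := by positivity
  simp only [conj_trivial] at h1
  linarith

lemma sphere_ne_zero (u : sphere (0 : EuclideanSpace ℝ (Fin n)) 1) :
    (u : EuclideanSpace ℝ (Fin n)) ≠ 0 := by
  intro h
  have := norm_eq_of_mem_sphere u
  rw [h] at this
  simp at this

/-- The barycentre is an interior point. -/
lemma exists_bary (hK : IsConvexBody K) : ∃ x0 ∈ interior K, ∫ x in K, (x - x0) = 0 := by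
  obtain ⟨hc, hconv, hinte⟩ := hK
  have hfin : volume K ≠ ⊤ := hc.measure_lt_top.ne
  have hpos : volume K ≠ 0 :=
    ((isOpen_interior.measure_pos volume hinte).trans_le (measure_mono interior_subset)).ne'
  have hI : IntegrableOn (fun x : EuclideanSpace ℝ (Fin n) => x) K :=
    continuous_id.continuousOn.integrableOn_compact hc
  have : IsFiniteMeasure (volume.restrict K) := ⟨by simpa using hc.measure_lt_top⟩
  refine ⟨⨍ x in K, x, ?_, ?_⟩
  · obtain ⟨y, hy⟩ := hinte
    obtain ⟨r, hr, hb⟩ := Metric.mem_nhds_iff.1 (isOpen_interior.mem_nhds hy)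
    have hsub : closedBall y (r/2) ⊆ interior K :=
      (closedBall_subset_ball (by linarith)).trans hb
    have hcb : volume (closedBall y (r/2)) ≠ 0 := (measure_closedBall_pos _ _ (by linarith)).ne'
    refine hconv.average_mem_interior_of_set (t := closedBall y (r/2)) ?_
      (ae_restrict_mem hc.measurableSet) hI ?_
    · rw [Measure.restrict_apply measurableSet_closedBall,
        inter_eq_left.2 (hsub.trans interior_subset)]
      exact hcb
    · rw [Measure.restrict_restrict measurableSet_closedBall,
        inter_eq_left.2 (hsub.trans interior_subset)]
      apply hsub
      have : IsFiniteMeasure (volume.restrict (closedBall y (r/2))) :=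
        ⟨by simpa using measure_closedBall_lt_top⟩
      have : NeZero (volume.restrict (closedBall y (r/2))) := ⟨by
        rw [Ne, Measure.restrict_eq_zero]; exact hcb⟩
      exact (convex_closedBall y (r/2)).average_mem isClosed_closedBall
        (ae_restrict_mem measurableSet_closedBall)
        (hI.mono_set (hsub.trans interior_subset))
  · rw [integral_sub hI (integrable_const _), setAverage_eq, integral_const]
    have : (volume.restrict K).real univ = volume.real K := by simp [Measure.real]
    rw [this, smul_smul, mul_inv_cancel₀, one_smul, sub_self]
    exact (ENNReal.toReal_pos hpos hfin).ne'

lemma santalo_body (hn : 1 ≤ n) (hK : IsConvexBody K) (hv : vol K = vol (unitBall n)) :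
    ∃ x0 ∈ interior K, ∫⁻ u : sphere (0 : EuclideanSpace ℝ (Fin n)) 1,
      ENNReal.ofReal ((supp K u - ⟪x0, (u : EuclideanSpace ℝ (Fin n))⟫)⁻¹ ^ n / n) ∂(sphMeasure n) ≤
        volume (ball (0 : EuclideanSpace ℝ (Fin n)) 1) := by
  obtain ⟨x0, hx0, hbar⟩ := exists_bary hK
  refine ⟨x0, hx0, ?_⟩
  obtain ⟨hc, hconv, hinte⟩ := hK
  have hne : K.Nonempty := hinte.mono interior_subset
  set h : EuclideanSpace ℝ (Fin n) → ℝ := fun y => supp K y - ⟪x0, y⟫ with hh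
  have hcont : Continuous h := (continuous_supp hc).sub (by fun_prop)
  have hhom : ∀ t : ℝ, 0 < t → ∀ x, h (t • x) = t * h x := by
    intro t ht x
    simp only [hh, supp_smul hc hne ht, inner_smul_right]
    ring
  have hpos : ∀ x, x ≠ 0 → 0 < h x := fun x hx => supp_pos hc hx0 hx
  have hh0 : ∀ x, 0 ≤ h x := by
    intro x
    have := supp_ge hc (interior_subset hx0) x
    simp only [hh]; linarith
  refine (polar_vol hn hhom hcont.measurable fun u => hpos _ (sphere_ne_zero u)).trans ?_
  -- the translated body
  set L : Set (EuclideanSpace ℝ (Fin n)) := (fun z => x0 + z) ⁻¹' K with hL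
  have hLc : IsCompact L := (Homeomorph.addLeft x0).isCompact_preimage.2 hc
  have hLconv : Convex ℝ L := hconv.translate_preimage_right x0
  have hLint : interior L = (fun z => x0 + z) ⁻¹' interior K :=
    ((Homeomorph.addLeft x0).preimage_interior K).symm
  have hL0 : L ∈ nhds (0 : EuclideanSpace ℝ (Fin n)) := by
    rw [← mem_interior_iff_mem_nhds, hLint]
    simpa using hx0
  have hset : {x | gauge L x < 1} = interior L := setOfPred_gauge_lt_one_eq_interior hLconv hL0
  have hae : interior L =ᵐ[volume] L := by
    have := hLconv.addHaar_frontier volume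
    exact interior_ae_eq_of_null_frontier this
  have mp : MeasurePreserving (fun z : EuclideanSpace ℝ (Fin n) => x0 + z) :=
    measurePreserving_add_left volume x0
  have hxy : ∀ x y, ⟪x, y⟫ ≤ gauge L x * h y := by
    intro x y
    have hmem : ∀ z ∈ L, ⟪z, y⟫ ≤ h y := by
      intro z hz
      have := supp_ge hc hz y
      rw [inner_add_left] at this
      simp only [hh]; linarith
    by_cases hx : x = 0
    · rw [hx, inner_zero_left, gauge_zero, zero_mul]
    have hg : 0 < gauge L x := (gauge_pos (absorbent_nhds_zero hL0)
      (NormedSpace.isVonNBounded_of_isBounded ℝ hLc.isBounded)).2 hx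
    have hm : (gauge L x)⁻¹ • x ∈ L := by
      have : (gauge L x)⁻¹ • x ∈ closure L := by
        rw [← gauge_le_one_iff_mem_closure hLconv hL0,
          gauge_smul_of_nonneg (inv_pos.2 hg).le, smul_eq_mul, inv_mul_cancel₀ hg.ne']
      rwa [hLc.isClosed.closure_eq] at this
    have := hmem _ hm
    rw [inner_smul_left] at this
    simp only [conj_trivial] at this
    rwa [inv_mul_le_iff₀ hg] at this
  refine santalo_gauge (γ := gauge L) (fun x => gauge_nonneg x)
    (fun t ht x => by rw [gauge_smul_of_nonneg ht.le, smul_eq_mul])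
    (continuous_gauge hLconv hL0).measurable hh0 hhom hcont.measurable hxy ?_ ?_ ?_
  · rw [hset]; exact hLc.isBounded.subset interior_subset
  · rw [hset, measure_congr hae, hL, mp.measure_preimage hc.measurableSet.nullMeasurableSet]
    have h1 := (ENNReal.toReal_eq_toReal_iff' hc.measure_lt_top.ne
      measure_closedBall_lt_top.ne).1 hv
    rw [h1]
    exact Measure.addHaar_unitClosedBall_eq_addHaar_unitBall _
  · intro i
    rw [hset, setIntegral_congr_set hae]
    have h1 : ∫ x in L, x = 0 := by
      have := mp.setIntegral_preimage_emb (measurableEmbedding_addLeft x0) (fun x => x - x0) K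
      rw [hbar] at this
      simpa only [add_sub_cancel_left] using this
    have h2 : IntegrableOn (fun x : EuclideanSpace ℝ (Fin n) => x) L :=
      continuous_id.continuousOn.integrableOn_compact hLc
    have h3 := (EuclideanSpace.proj i : EuclideanSpace ℝ (Fin n) →L[ℝ] ℝ).integral_comp_comm h2
    rw [h1] at h3
    simpa using h3

end Support

section MinusTwo
variable {n : ℕ} {K : Set (EuclideanSpace ℝ (Fin n))}

instance sphMeasure_finite (n : ℕ) : IsFiniteMeasure (sphMeasure n) := by
  unfold sphMeasure; infer_instance

lemma integrable_sph {f : sphere (0 : EuclideanSpace ℝ (Fin n)) 1 → ℝ} (hf : Continuous f) :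
    Integrable f (sphMeasure n) :=
  hf.integrable_of_hasCompactSupport (HasCompactSupport.of_compactSpace _)

lemma continuous_hx (hK : IsCompact K) (x : EuclideanSpace ℝ (Fin n)) :
    Continuous fun u : sphere (0 : EuclideanSpace ℝ (Fin n)) 1 =>
      supp K u - ⟪x, (u : EuclideanSpace ℝ (Fin n))⟫ :=
  ((continuous_supp hK).comp continuous_subtype_val).sub (by fun_prop)

lemma hx_pos (hK : IsCompact K) {x : EuclideanSpace ℝ (Fin n)} (hx : x ∈ interior K)
    (u : sphere (0 : EuclideanSpace ℝ (Fin n)) 1) :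
    0 < supp K u - ⟪x, (u : EuclideanSpace ℝ (Fin n))⟫ :=
  supp_pos hK hx (sphere_ne_zero u)

lemma continuous_hx_rpow (hK : IsCompact K) {x : EuclideanSpace ℝ (Fin n)} (hx : x ∈ interior K)
    (p : ℝ) : Continuous fun u : sphere (0 : EuclideanSpace ℝ (Fin n)) 1 =>
      (supp K u - ⟪x, (u : EuclideanSpace ℝ (Fin n))⟫) ^ p :=
  (continuous_hx hK x).rpow_const fun u => Or.inl (hx_pos hK hx u).ne'

lemma bernoulli_sq {n : ℕ} (hn : 2 ≤ n) {y : ℝ} (hy : 0 ≤ y) :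
    y ^ 2 ≤ 2 * (y ^ n / n) + (1 - 2 / n) := by
  have hn' : (2:ℝ) ≤ n := by exact_mod_cast hn
  have h := one_add_mul_self_le_rpow_one_add (s := y ^ 2 - 1) (by nlinarith [sq_nonneg y])
    (p := (n:ℝ) / 2) (by linarith)
  have h2 : (1 + (y ^ 2 - 1)) ^ ((n:ℝ) / 2) = y ^ n := by
    rw [add_sub_cancel, ← Real.rpow_natCast y 2, ← Real.rpow_mul hy, ← Real.rpow_natCast]
    congr 1
    push_cast
    ring
  rw [h2] at h
  have h3 : y ^ 2 * n ≤ 2 * y ^ n + (n - 2) := by linarith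
  have hnp : (0:ℝ) < n := by linarith
  have h4 : 2 * (y ^ n / n) + (1 - 2 / n) = (2 * y ^ n + (n - 2)) / n := by
    field_simp
  rw [h4, le_div_iff₀ hnp]
  exact h3

lemma exists_two (hn : 2 ≤ n) (hK : IsConvexBody K) (hv : vol K = vol (unitBall n)) :
    ∃ x ∈ interior K, ∫ u : sphere (0 : EuclideanSpace ℝ (Fin n)) 1,
      (supp K u - ⟪x, (u : EuclideanSpace ℝ (Fin n))⟫) ^ (-2 : ℝ) ∂(sphMeasure n) ≤
        (sphMeasure n).real univ := by
  obtain ⟨x, hx, hle⟩ := santalo_body (by omega) hK hv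
  refine ⟨x, hx, ?_⟩
  have hpos := hx_pos hK.1 hx
  set h := fun u : sphere (0 : EuclideanSpace ℝ (Fin n)) 1 =>
    supp K u - ⟪x, (u : EuclideanSpace ℝ (Fin n))⟫ with hh
  have hc : Continuous h := continuous_hx hK.1 x
  have hci : Continuous fun u => (h u)⁻¹ := hc.inv₀ fun u => (hpos u).ne'
  have hi1 : Integrable (fun u => (h u)⁻¹ ^ n / n) (sphMeasure n) :=
    integrable_sph ((hci.pow n).div_const _)
  have hnn : ∀ u, 0 ≤ (h u)⁻¹ ^ n / n := fun u => by
    have := hpos u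
    have : 0 < h u := this
    positivity
  rw [← ofReal_integral_eq_lintegral_ofReal hi1 (Filter.Eventually.of_forall hnn)] at hle
  have hI : ∫ u, (h u)⁻¹ ^ n / n ∂(sphMeasure n) ≤
      volume.real (ball (0 : EuclideanSpace ℝ (Fin n)) 1) :=
    (ENNReal.ofReal_le_iff_le_toReal measure_ball_lt_top.ne).1 hle
  have hω : (sphMeasure n).real univ = n * volume.real (ball (0 : EuclideanSpace ℝ (Fin n)) 1) := by
    unfold sphMeasure
    rw [Measure.toSphere_real_apply_univ]; simp
  have hn0 : (0:ℝ) < n := by exact_mod_cast (by omega : 0 < n)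
  calc ∫ u, h u ^ (-2 : ℝ) ∂(sphMeasure n)
      ≤ ∫ u, (2 * ((h u)⁻¹ ^ n / n) + (1 - 2 / n)) ∂(sphMeasure n) := by
        refine integral_mono (integrable_sph (continuous_hx_rpow hK.1 hx _))
          ((hi1.const_mul 2).add (integrable_const _)) fun u => ?_
        have h0 : 0 < h u := hpos u
        have : h u ^ (-2 : ℝ) = (h u)⁻¹ ^ 2 := by
          rw [Real.rpow_neg h0.le, inv_pow]
          norm_cast
        simp only [this]
        exact bernoulli_sq hn (inv_pos.2 h0).le
    _ = 2 * (∫ u, (h u)⁻¹ ^ n / n ∂(sphMeasure n)) + (1 - 2 / n) * (sphMeasure n).real univ := by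
        rw [integral_add (hi1.const_mul 2) (integrable_const _), integral_const_mul, integral_const,
          smul_eq_mul, mul_comm ((sphMeasure n).real univ)]
    _ ≤ 2 * volume.real (ball (0 : EuclideanSpace ℝ (Fin n)) 1) +
          (1 - 2 / n) * (sphMeasure n).real univ := by gcongr
    _ = _ := by
        rw [hω]; field_simp; ring

lemma exists_one {K : Set (EuclideanSpace ℝ (Fin 1))} (hK : IsConvexBody K)
    (hv : vol K = vol (unitBall 1)) :
    ∃ x ∈ interior K, ∫ u : sphere (0 : EuclideanSpace ℝ (Fin 1)) 1,
      (supp K u - ⟪x, (u : EuclideanSpace ℝ (Fin 1))⟫) ^ (-2 : ℝ) ∂(sphMeasure 1) ≤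
        (sphMeasure 1).real univ := by
  obtain ⟨hc, hconv, hinte⟩ := hK
  have hne : K.Nonempty := hinte.mono interior_subset
  have hcc : Continuous fun y : EuclideanSpace ℝ (Fin 1) => y 0 := by fun_prop
  obtain ⟨pa, hpa, ha⟩ := hc.exists_isMinOn hne hcc.continuousOn
  obtain ⟨pb, hpb, hb⟩ := hc.exists_isMaxOn hne hcc.continuousOn
  have ha' : ∀ y ∈ K, pa 0 ≤ y 0 := fun y hy => ha hy
  have hb' : ∀ y ∈ K, y 0 ≤ pb 0 := fun y hy => hb hy
  have hnorm : ∀ z : EuclideanSpace ℝ (Fin 1), ‖z‖ = |z 0| := by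
    intro z; rw [EuclideanSpace.norm_eq]; simp [Real.sqrt_sq_eq_abs]
  have hinn : ∀ z w : EuclideanSpace ℝ (Fin 1), ⟪z, w⟫ = z 0 * w 0 := by
    intro z w; simp [PiLp.inner_apply, mul_comm]
  set x : EuclideanSpace ℝ (Fin 1) := (1/2 : ℝ) • (pa + pb) with hx
  have hx0 : x 0 = (pa 0 + pb 0) / 2 := by simp [hx]; ring
  set r := (pb 0 - pa 0) / 2 with hr
  have hr0 : 0 ≤ r := by have := ha' _ hpb; linarith
  have hsub : K ⊆ closedBall x r := by
    intro y hy
    rw [mem_closedBall, dist_eq_norm, hnorm, abs_le]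
    simp only [PiLp.sub_apply, hx0]
    have := ha' y hy
    have := hb' y hy
    constructor <;> linarith
  have hr1 : 1 ≤ r := by
    have h1 : vol K ≤ r * vol (unitBall 1) := by
      unfold vol unitBall
      have := measure_mono hsub (μ := volume)
      rw [Measure.addHaar_closedBall' _ _ hr0] at this
      have h2 := ENNReal.toReal_mono (ENNReal.mul_ne_top ENNReal.ofReal_ne_top
        measure_closedBall_lt_top.ne) this
      rw [ENNReal.toReal_mul, ENNReal.toReal_ofReal (by positivity)] at h2
      simpa using h2
    have h2 : 0 < vol (unitBall 1) :=
      ENNReal.toReal_pos (measure_closedBall_pos _ _ one_pos).ne' measure_closedBall_lt_top.ne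
    rw [hv] at h1
    by_contra hcon
    push Not at hcon
    nlinarith
  have hin : x ∈ interior K := by
    rw [mem_interior_iff_mem_nhds, Metric.mem_nhds_iff]
    refine ⟨r, by linarith, fun z hz => ?_⟩
    rw [mem_ball, dist_eq_norm, hnorm, abs_lt] at hz
    simp only [PiLp.sub_apply, hx0] at hz
    have hd : 0 < pb 0 - pa 0 := by linarith
    have hz' : z = ((pb 0 - z 0) / (pb 0 - pa 0)) • pa + ((z 0 - pa 0) / (pb 0 - pa 0)) • pb := by
      ext i
      fin_cases i
      simp
      field_simp
      ring
    rw [hz']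
    refine hconv hpa hpb (div_nonneg (by linarith) hd.le) (div_nonneg (by linarith) hd.le) ?_
    field_simp
    ring
  refine ⟨x, hin, ?_⟩
  have hh : ∀ u : sphere (0 : EuclideanSpace ℝ (Fin 1)) 1,
      1 ≤ supp K u - ⟪x, (u : EuclideanSpace ℝ (Fin 1))⟫ := by
    intro u
    have h1 := supp_ge hc hpa (u : EuclideanSpace ℝ (Fin 1))
    have h2 := supp_ge hc hpb (u : EuclideanSpace ℝ (Fin 1))
    have hu := norm_eq_of_mem_sphere u
    rw [hnorm] at hu
    rw [hinn] at h1 h2 ⊢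
    rw [hx0]
    rcases abs_eq (by norm_num) |>.1 hu with h | h <;> rw [h] at h1 h2 ⊢ <;> linarith
  calc _ ≤ ∫ u : sphere (0 : EuclideanSpace ℝ (Fin 1)) 1, (1:ℝ) ∂(sphMeasure 1) := by
        refine integral_mono (integrable_sph (continuous_hx_rpow hc hin _)) (integrable_const _)
          fun u => ?_
        exact Real.rpow_le_one_of_one_le_of_nonpos (hh u) (by norm_num)
    _ = _ := by simp

lemma exists_minus_two (hn : 1 ≤ n) (hK : IsConvexBody K) (hv : vol K = vol (unitBall n)) :
    ∃ x ∈ interior K, ∫ u : sphere (0 : EuclideanSpace ℝ (Fin n)) 1,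
      (supp K u - ⟪x, (u : EuclideanSpace ℝ (Fin n))⟫) ^ (-2 : ℝ) ∂(sphMeasure n) ≤
        (sphMeasure n).real univ := by
  rcases hn.eq_or_lt with h | h
  · subst h; exact exists_one hK hv
  · exact exists_two h hK hv

end MinusTwo

section Final
variable {n : ℕ} {K : Set (EuclideanSpace ℝ (Fin n))}

lemma exists_kappa (n : ℕ) : ∃ κ : ℝ, 0 < κ ∧ ∀ v : EuclideanSpace ℝ (Fin n), ‖v‖ = 1 →
    κ ≤ (sphMeasure n).real {u | 1 / 2 < ⟪v, (u : EuclideanSpace ℝ (Fin n))⟫} := by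
  refine ⟨Measure.toSphereBallBound (Module.finrank ℝ (EuclideanSpace ℝ (Fin n))) 1 *
    volume.real (ball (0 : EuclideanSpace ℝ (Fin n)) 1), ?_, fun v hv => ?_⟩
  · refine mul_pos (by exact_mod_cast Measure.toSphereBallBound_pos _ _) ?_
    exact ENNReal.toReal_pos (measure_ball_pos _ _ one_pos).ne' measure_ball_lt_top.ne
  · refine (Measure.toSphereBallBound_mul_measureReal_unitBall_le_toSphere_ball volume one_pos
      ⟨v, by simpa using hv⟩).trans ?_
    unfold sphMeasure
    refine measureReal_mono ?_
    intro u hu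
    have h1 : ‖(u : EuclideanSpace ℝ (Fin n)) - v‖ < 1 := by
      rw [mem_ball, Subtype.dist_eq, dist_eq_norm] at hu
      exact hu
    have h2 := norm_eq_of_mem_sphere u
    have h3 := norm_sub_sq_real (u : EuclideanSpace ℝ (Fin n)) v
    rw [h2, hv] at h3
    have h4 : ‖(u : EuclideanSpace ℝ (Fin n)) - v‖ ^ 2 < 1 := by
      nlinarith [norm_nonneg ((u : EuclideanSpace ℝ (Fin n)) - v)]
    rw [mem_ofPred_eq, real_inner_comm]
    linarith

lemma measurable_cap (v : EuclideanSpace ℝ (Fin n)) :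
    MeasurableSet {u : sphere (0 : EuclideanSpace ℝ (Fin n)) 1 |
      1 / 2 < ⟪v, (u : EuclideanSpace ℝ (Fin n))⟫} :=
  measurableSet_lt measurable_const (by fun_prop)

lemma cap_integral {κ : ℝ} {v : EuclideanSpace ℝ (Fin n)}
    (hκ : κ ≤ (sphMeasure n).real {u | 1 / 2 < ⟪v, (u : EuclideanSpace ℝ (Fin n))⟫})
    {f : sphere (0 : EuclideanSpace ℝ (Fin n)) 1 → ℝ} (hf : Continuous f) {c : ℝ} (hc : 0 ≤ c)
    (hf0 : ∀ u, 0 ≤ f u) (hfc : ∀ u : sphere (0 : EuclideanSpace ℝ (Fin n)) 1,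
      1 / 2 < ⟪v, (u : EuclideanSpace ℝ (Fin n))⟫ → c ≤ f u) :
    κ * c ≤ ∫ u, f u ∂(sphMeasure n) := by
  have hm := measurable_cap v
  set A := {u : sphere (0 : EuclideanSpace ℝ (Fin n)) 1 |
      1 / 2 < ⟪v, (u : EuclideanSpace ℝ (Fin n))⟫} with hA
  calc κ * c ≤ (sphMeasure n).real A * c := by gcongr
    _ = ∫ u, A.indicator (fun _ => c) u ∂(sphMeasure n) := by
        rw [integral_indicator hm, setIntegral_const, smul_eq_mul]
    _ ≤ _ := by
        refine integral_mono ((integrable_const c).indicator hm) (integrable_sph hf) fun u => ?_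
        by_cases hu : u ∈ A
        · rw [indicator_of_mem hu]; exact hfc u hu
        · rw [indicator_of_notMem hu]; exact hf0 u

lemma continuous_log_hx (hK : IsCompact K) {x : EuclideanSpace ℝ (Fin n)} (hx : x ∈ interior K) :
    Continuous fun u : sphere (0 : EuclideanSpace ℝ (Fin n)) 1 =>
      Real.log (supp K u - ⟪x, (u : EuclideanSpace ℝ (Fin n))⟫) :=
  (continuous_hx hK x).log fun u => (hx_pos hK hx u).ne'

lemma hx_le (hne : K.Nonempty) {x : EuclideanSpace ℝ (Fin n)} {D : ℝ}
    (hD : ∀ y ∈ K, ‖y - x‖ ≤ D) (u : sphere (0 : EuclideanSpace ℝ (Fin n)) 1) :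
    supp K u - ⟪x, (u : EuclideanSpace ℝ (Fin n))⟫ ≤ D := by
  rw [sub_le_iff_le_add]
  refine supp_le hne fun y hy => ?_
  have h1 := real_inner_le_norm (y - x) (u : EuclideanSpace ℝ (Fin n))
  rw [norm_eq_of_mem_sphere u, mul_one, inner_sub_left] at h1
  linarith [hD y hy]

lemma le_entropy (hK : IsConvexBody K) {x : EuclideanSpace ℝ (Fin n)} (hx : x ∈ interior K) :
    ∫ u, Real.log (supp K u - ⟪x, (u : EuclideanSpace ℝ (Fin n))⟫) ∂(sphMeasure n) ≤
      entropy K := by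
  refine le_csSup ⟨diam K * (sphMeasure n).real univ, ?_⟩ ⟨x, hx, rfl⟩
  rintro _ ⟨z, hz, rfl⟩
  calc ∫ u, Real.log (supp K u - ⟪z, (u : EuclideanSpace ℝ (Fin n))⟫) ∂(sphMeasure n)
      ≤ ∫ _u, diam K ∂(sphMeasure n) := by
        refine integral_mono (integrable_sph (continuous_log_hx hK.1 hz)) (integrable_const _)
          fun u => ?_
        have h1 := Real.log_le_sub_one_of_pos (hx_pos hK.1 hz u)
        have h2 := hx_le (hK.2.2.mono interior_subset) (x := z) (D := diam K) (fun y hy => by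
          rw [← dist_eq_norm]
          exact dist_le_diam_of_mem hK.1.isBounded hy (interior_subset hz)) u
        simp only
        linarith
    _ = _ := by rw [integral_const, smul_eq_mul, mul_comm]

lemma log_ge_rpow {h : ℝ} (hh : 0 < h) : (1 - h ^ (-2 : ℝ)) / 2 ≤ Real.log h := by
  have hp : 0 < h ^ (-2 : ℝ) := Real.rpow_pos_of_pos hh _
  have h1 := Real.log_le_sub_one_of_pos hp
  rw [Real.log_rpow hh] at h1
  linarith

lemma log_mid {a b s : ℝ} (ha : 0 < a) (hb : 0 < b) (hs : 2 * s = a + b) :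
    (a - b) ^ 2 / (8 * s ^ 2) ≤ Real.log s - (Real.log a + Real.log b) / 2 := by
  have hsp : 0 < s := by linarith
  have h1 := Real.log_le_sub_one_of_pos (show 0 < a * b / s ^ 2 by positivity)
  rw [Real.log_div (by positivity) (by positivity), Real.log_mul ha.ne' hb.ne', Real.log_pow] at h1
  have h2 : (a - b) ^ 2 / (8 * s ^ 2) = (1 - a * b / s ^ 2) / 2 := by
    field_simp
    have : b = 2 * s - a := by linarith
    subst this
    ring
  rw [h2]
  push_cast at h1
  linarith

/-- Bound on the size of `K` seen from `e₂`. -/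
lemma size_bound {κ : ℝ} (hκ0 : 0 < κ) (hκ : ∀ v : EuclideanSpace ℝ (Fin n), ‖v‖ = 1 →
    κ ≤ (sphMeasure n).real {u | 1 / 2 < ⟪v, (u : EuclideanSpace ℝ (Fin n))⟫})
    (hK : IsConvexBody K) {x : EuclideanSpace ℝ (Fin n)} (hx : x ∈ interior K)
    (hΦ : ∫ u, Real.log (supp K u - ⟪x, (u : EuclideanSpace ℝ (Fin n))⟫) ∂(sphMeasure n) ≤ 1)
    (hI : ∫ u : sphere (0 : EuclideanSpace ℝ (Fin n)) 1,
      (supp K u - ⟪x, (u : EuclideanSpace ℝ (Fin n))⟫) ^ (-2 : ℝ) ∂(sphMeasure n) ≤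
        (sphMeasure n).real univ) {y : EuclideanSpace ℝ (Fin n)} (hy : y ∈ K) :
    ‖y - x‖ ≤ 2 * Real.exp ((1 + (sphMeasure n).real univ / 2) / κ) := by
  set ω := (sphMeasure n).real univ with hω
  have hω0 : 0 ≤ ω := measureReal_nonneg
  set R := ‖y - x‖ with hR
  by_cases hR2 : R ≤ 2
  · refine hR2.trans ?_
    have : 1 ≤ Real.exp ((1 + ω / 2) / κ) := Real.one_le_exp (by positivity)
    linarith
  push Not at hR2
  have hR0 : 0 < R := by linarith
  have hv : ‖R⁻¹ • (y - x)‖ = 1 := by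
    rw [norm_smul, Real.norm_of_nonneg (by positivity), ← hR, inv_mul_cancel₀ hR0.ne']
  have hc1 := continuous_log_hx hK.1 hx
  have hc2 := continuous_hx_rpow hK.1 hx (-2)
  have key := cap_integral (hκ _ hv)
    (f := fun u => Real.log (supp K u - ⟪x, (u : EuclideanSpace ℝ (Fin n))⟫) +
      (supp K u - ⟪x, (u : EuclideanSpace ℝ (Fin n))⟫) ^ (-2 : ℝ) / 2)
    (hc1.add (hc2.div_const 2)) (c := Real.log (R / 2))
    (Real.log_nonneg (by linarith)) (fun u => by
      have := log_ge_rpow (hx_pos hK.1 hx u)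
      linarith) (fun u hu => by
      have h0 := hx_pos hK.1 hx u
      have h1 := supp_ge hK.1 hy (u : EuclideanSpace ℝ (Fin n))
      rw [inner_smul_left, conj_trivial, inv_mul_eq_div, lt_div_iff₀ hR0, inner_sub_left] at hu
      have h2 : Real.log (R / 2) ≤ Real.log (supp K u - ⟪x, (u : EuclideanSpace ℝ (Fin n))⟫) :=
        Real.log_le_log (by linarith) (by linarith)
      have h3 := Real.rpow_pos_of_pos h0 (-2)
      linarith)
  rw [integral_add (integrable_sph hc1) ((integrable_sph hc2).div_const 2), integral_div] at key
  have h4 : Real.log (R / 2) ≤ (1 + ω / 2) / κ := by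
    rw [le_div_iff₀ hκ0]; linarith
  have h5 := (Real.log_le_iff_le_exp (by linarith)).1 h4
  linarith

end Final


/-- There is `c_n > 0` such that if `V(K) = V(B)` and `𝓔(K) ≤ ε ≤ 1`,
then `|e_{-2}(K) - e(K)| ≤ c_n √ε`. -/
theorem statement11 (n : ℕ) (hn : 1 ≤ n) :
    ∃ c : ℝ, 0 < c ∧
      ∀ K : Set (EuclideanSpace ℝ (Fin n)), IsConvexBody K →
        vol K = vol (unitBall n) →
        ∀ ε : ℝ, entropy K ≤ ε → ε ≤ 1 →
          ∀ e ∈ interior K,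
            (∫ u, Real.log (supp K u - ⟪e, (u : EuclideanSpace ℝ (Fin n))⟫)
                ∂(sphMeasure n)) = entropy K →
            ∀ e₂ ∈ interior K,
              (∀ x ∈ interior K,
                (∫ u, (supp K u - ⟪e₂, (u : EuclideanSpace ℝ (Fin n))⟫) ^ (-2 : ℝ)
                    ∂(sphMeasure n))
                  ≤ ∫ u, (supp K u - ⟪x, (u : EuclideanSpace ℝ (Fin n))⟫) ^ (-2 : ℝ)
                      ∂(sphMeasure n)) →
              ‖e₂ - e‖ ≤ c * Real.sqrt ε := by
  obtain ⟨κ, hκ0, hκ⟩ := exists_kappa n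
  set R0 := 2 * Real.exp ((1 + (sphMeasure n).real univ / 2) / κ) with hR0
  have hR0p : 0 < R0 := by positivity
  refine ⟨Real.sqrt (64 * R0 ^ 2 / κ), by positivity, ?_⟩
  intro K hK hv ε hE hε e he heE e₂ he₂ hmin
  obtain ⟨x, hx, hxle⟩ := exists_minus_two hn hK hv
  have hI := (hmin x hx).trans hxle
  have hc := hK.1
  have hne : K.Nonempty := hK.2.2.mono interior_subset
  have hl₂ := integrable_sph (continuous_log_hx hc he₂)
  have hl := integrable_sph (continuous_log_hx hc he)
  have hΦ₂ := le_entropy hK he₂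
  have hΦ0 : 0 ≤ ∫ u, Real.log (supp K u - ⟪e₂, (u : EuclideanSpace ℝ (Fin n))⟫)
      ∂(sphMeasure n) := by
    have hi := integrable_sph (continuous_hx_rpow hc he₂ (-2))
    calc (0:ℝ) ≤ ((sphMeasure n).real univ - ∫ u : sphere (0 : EuclideanSpace ℝ (Fin n)) 1,
          (supp K u - ⟪e₂, (u : EuclideanSpace ℝ (Fin n))⟫) ^ (-2 : ℝ) ∂(sphMeasure n)) / 2 := by
          linarith
      _ = ∫ u : sphere (0 : EuclideanSpace ℝ (Fin n)) 1,
          (1 - (supp K u - ⟪e₂, (u : EuclideanSpace ℝ (Fin n))⟫) ^ (-2 : ℝ)) / 2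
            ∂(sphMeasure n) := by
          rw [integral_div, integral_sub (integrable_const _) hi, integral_const, smul_eq_mul,
            mul_one]
      _ ≤ _ := integral_mono (((integrable_const _).sub hi).div_const 2) hl₂ fun u =>
          log_ge_rpow (hx_pos hc he₂ u)
  have hsize : ∀ y ∈ K, ‖y - e₂‖ ≤ R0 := fun y hy =>
    size_bound hκ0 hκ hK he₂ (by linarith) hI hy
  set m := (1/2 : ℝ) • e + (1/2 : ℝ) • e₂ with hm
  have hmK : m ∈ interior K :=
    hK.2.1.interior he he₂ (by norm_num) (by norm_num) (by norm_num)
  have hmsize : ∀ y ∈ K, ‖y - m‖ ≤ 2 * R0 := by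
    intro y hy
    have h1 := hsize y hy
    have h2 := hsize m (interior_subset hmK)
    have h3 := norm_sub_le_norm_sub_add_norm_sub y e₂ m
    rw [norm_sub_rev e₂ m] at h3
    linarith
  have hlm := integrable_sph (continuous_log_hx hc hmK)
  have hΦm := le_entropy hK hmK
  have hε0 : 0 ≤ ε := by linarith
  by_cases hw : e₂ - e = 0
  · rw [hw, norm_zero]; positivity
  have hw0 : 0 < ‖e₂ - e‖ := norm_pos_iff.2 hw
  have hvn : ‖‖e₂ - e‖⁻¹ • (e₂ - e)‖ = 1 := by
    rw [norm_smul, norm_inv, norm_norm, inv_mul_cancel₀ hw0.ne']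
  have hcap := cap_integral (hκ _ hvn)
    (f := fun u => ⟪e₂ - e, (u : EuclideanSpace ℝ (Fin n))⟫ ^ 2 / (8 * (2 * R0) ^ 2))
    (by fun_prop) (c := (‖e₂ - e‖ / 2) ^ 2 / (8 * (2 * R0) ^ 2)) (by positivity)
    (fun u => by positivity) (fun u hu => by
      rw [inner_smul_left, conj_trivial, inv_mul_eq_div, lt_div_iff₀ hw0] at hu
      gcongr
      linarith)
  have hmid : ∫ u : sphere (0 : EuclideanSpace ℝ (Fin n)) 1,
      ⟪e₂ - e, (u : EuclideanSpace ℝ (Fin n))⟫ ^ 2 / (8 * (2 * R0) ^ 2) ∂(sphMeasure n) ≤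
      ∫ u, (Real.log (supp K u - ⟪m, (u : EuclideanSpace ℝ (Fin n))⟫) -
        (Real.log (supp K u - ⟪e, (u : EuclideanSpace ℝ (Fin n))⟫) +
          Real.log (supp K u - ⟪e₂, (u : EuclideanSpace ℝ (Fin n))⟫)) / 2) ∂(sphMeasure n) := by
    refine integral_mono (integrable_sph (by fun_prop)) (hlm.sub ((hl.add hl₂).div_const 2))
      fun u => ?_
    have ha := hx_pos hc he u
    have hb := hx_pos hc he₂ u
    have hs := hx_pos hc hmK u
    have hsle := hx_le hne hmsize u
    have h1 := log_mid ha hb (s := supp K u - ⟪m, (u : EuclideanSpace ℝ (Fin n))⟫) (by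
      rw [hm, inner_add_left, inner_smul_left, inner_smul_left]
      simp only [conj_trivial]
      ring)
    refine le_trans ?_ h1
    have h2 : ⟪e₂ - e, (u : EuclideanSpace ℝ (Fin n))⟫ =
        (supp K u - ⟪e, (u : EuclideanSpace ℝ (Fin n))⟫) -
          (supp K u - ⟪e₂, (u : EuclideanSpace ℝ (Fin n))⟫) := by
      rw [inner_sub_left]; ring
    simp only [h2]
    gcongr
  have hadd : Integrable (fun u : sphere (0 : EuclideanSpace ℝ (Fin n)) 1 =>
      Real.log (supp K u - ⟪e, (u : EuclideanSpace ℝ (Fin n))⟫) +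
        Real.log (supp K u - ⟪e₂, (u : EuclideanSpace ℝ (Fin n))⟫)) (sphMeasure n) := hl.add hl₂
  replace hmid := hcap.trans hmid
  rw [integral_sub hlm (hadd.div_const 2), integral_div, integral_add hl hl₂, heE] at hmid
  have hfin : κ * ((‖e₂ - e‖ / 2) ^ 2 / (8 * (2 * R0) ^ 2)) ≤ ε / 2 := by linarith
  have hsq : ‖e₂ - e‖ ^ 2 ≤ 64 * R0 ^ 2 / κ * ε := by
    have h1 : κ * ((‖e₂ - e‖ / 2) ^ 2 / (8 * (2 * R0) ^ 2)) =
        (κ * ‖e₂ - e‖ ^ 2) / (128 * R0 ^ 2) := by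
      field_simp
      ring
    rw [h1, div_le_iff₀ (by positivity)] at hfin
    rw [div_mul_eq_mul_div, le_div_iff₀ hκ0]
    linarith
  rw [← Real.sqrt_mul (by positivity)]
  exact Real.le_sqrt_of_sq_le hsq
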